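/- arXiv:2302.11474 — 10 statements merged into one kernel-verified Lean document; each statement's English description precedes it below -/
import Mathlib

section
/- Let A be an m x n real matrix of rank n, let q = (q_1, ..., q_m) be a probability distribution on {1, ..., m} with q_j > 0 for every j, let d >= 1 be an integer, and let epsilon be in (0,1). Let S be the random d x m matrix whose d rows are independent and identically distributed, each row equal to (delta_j)^T / sqrt(d q_j) with probability q_j, where delta_j is the j-th standard basis vector of R^m. Set r = min_j q_j / p_j(A), where the minimum is over indices j with p_j(A) > 0. Then the probability that there exists y in range(A) violating (1-epsilon)||y||_2^2 <= ||S y||_2^2 <= (1+epsilon)||y||_2^2 is at most 2 n ( exp(epsilon) / (1+epsilon)^(1+epsilon) )^( r d / n ). Moreover, exp(epsilon) < (1+epsilon)^(1+epsilon) for every epsilon in (0,1). -/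
open MeasureTheory Matrix

/-- The `j`-th leverage score of `A`: `A[j,:] (AᵀA)⁻¹ A[j,:]ᵀ`. -/
noncomputable def lev {m n : ℕ} (A : Matrix (Fin m) (Fin n) ℝ) (j : Fin m) : ℝ :=
  ∑ a, A j a * ((Aᵀ * A)⁻¹).mulVec (A j) a

/-- The leverage score distribution: `p_j(A) = l_j(A) / n`. -/
noncomputable def levDist {m n : ℕ} (A : Matrix (Fin m) (Fin n) ℝ) (j : Fin m) : ℝ :=
  lev A j / n

/-- The random row-sampling sketching operator: given the sampled indices
`ω : Fin d → Fin m`, the `i`-th row is `δ_{ω i}ᵀ / sqrt(d q_{ω i})`. -/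
noncomputable def sampleMatrix {m d : ℕ} (q : Fin m → ℝ) (ω : Fin d → Fin m) :
    Matrix (Fin d) (Fin m) ℝ :=
  Matrix.of fun i j => if ω i = j then 1 / Real.sqrt (d * q j) else 0


/-- Telescoping bound for powers in a normed ring. -/
lemma aux_pow_sub {R : Type*} [NormedRing R] [NormOneClass R] (X Y : R) (M : ℝ) (hM : 1 ≤ M)
    (hX : ‖X‖ ≤ M) (hY : ‖Y‖ ≤ M) (N : ℕ) :
    ‖X ^ N - Y ^ N‖ ≤ N * M ^ N * ‖X - Y‖ := by
  induction N with
  | zero => simp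
  | succ k ih =>
    have e : X ^ (k+1) - Y ^ (k+1) = (X ^ k - Y ^ k) * X + Y ^ k * (X - Y) := by
      rw [pow_succ, pow_succ]; noncomm_ring
    have hYk : ‖Y ^ k‖ ≤ M ^ k :=
      (norm_pow_le Y k).trans (pow_le_pow_left₀ (norm_nonneg _) hY k)
    have hMk : M ^ k ≤ M ^ (k+1) := pow_le_pow_right₀ hM (Nat.le_succ k)
    calc ‖X ^ (k+1) - Y ^ (k+1)‖ ≤ ‖X ^ k - Y ^ k‖ * ‖X‖ + ‖Y ^ k‖ * ‖X - Y‖ := by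
          rw [e]
          exact (norm_add_le _ _).trans (add_le_add (norm_mul_le _ _) (norm_mul_le _ _))
      _ ≤ (k * M ^ k * ‖X - Y‖) * M + M ^ (k+1) * ‖X - Y‖ := by
          gcongr
          exact hYk.trans hMk
      _ = _ := by push_cast; ring

open Filter Topology Asymptotics in
/-- Lie product formula along powers of two. -/
lemma aux_trotter {R : Type*} [NormedRing R] [NormOneClass R] [NormedAlgebra ℝ R] [CompleteSpace R]
    (A B : R) :
    Tendsto (fun k : ℕ => (NormedSpace.exp ((((2:ℝ) ^ k)⁻¹) • A) *
      NormedSpace.exp ((((2:ℝ) ^ k)⁻¹) • B)) ^ (2 ^ k)) atTop (𝓝 (NormedSpace.exp (A + B))) := by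
  set F : ℝ → R := fun t => NormedSpace.exp (t • A) * NormedSpace.exp (t • B) with hF
  set G : ℝ → R := fun t => NormedSpace.exp (t • (A + B)) with hG
  have hF' : HasDerivAt F (A + B) 0 := by
    have h1 := hasDerivAt_exp_smul_const (𝕂 := ℝ) A 0
    have h2 := hasDerivAt_exp_smul_const (𝕂 := ℝ) B 0
    have := h1.mul h2
    simp only [zero_smul, NormedSpace.exp_zero, one_mul, mul_one] at this
    exact this
  have hG' : HasDerivAt G (A + B) 0 := by
    have h1 := hasDerivAt_exp_smul_const (𝕂 := ℝ) (A + B) 0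
    simp only [zero_smul, NormedSpace.exp_zero, one_mul] at h1
    exact h1
  have hF0 : F 0 = 1 := by simp [hF]
  have hG0 : G 0 = 1 := by simp [hG]
  have hlim : Tendsto (fun k : ℕ => ((2:ℝ) ^ k)⁻¹) atTop (𝓝 0) := by
    have := tendsto_pow_atTop_nhds_zero_of_lt_one (r := (2:ℝ)⁻¹) (by norm_num) (by norm_num)
    simpa [inv_pow] using this
  have hFO : ∃ C, ∀ᶠ k : ℕ in atTop, ‖F ((2:ℝ) ^ k)⁻¹ - 1‖ ≤ C * ((2:ℝ) ^ k)⁻¹ := by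
    obtain ⟨C, hC⟩ := hF'.isBigO_sub.bound
    refine ⟨C, ?_⟩
    filter_upwards [hlim.eventually hC] with k hk
    have : |((2:ℝ) ^ k)⁻¹| = ((2:ℝ) ^ k)⁻¹ := abs_of_pos (by positivity)
    simpa [hF0, Real.norm_eq_abs, this] using hk
  have hGO : ∃ C, ∀ᶠ k : ℕ in atTop, ‖G ((2:ℝ) ^ k)⁻¹ - 1‖ ≤ C * ((2:ℝ) ^ k)⁻¹ := by
    obtain ⟨C, hC⟩ := hG'.isBigO_sub.bound
    refine ⟨C, ?_⟩
    filter_upwards [hlim.eventually hC] with k hk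
    have : |((2:ℝ) ^ k)⁻¹| = ((2:ℝ) ^ k)⁻¹ := abs_of_pos (by positivity)
    simpa [hG0, Real.norm_eq_abs, this] using hk
  obtain ⟨C1, hC1⟩ := hFO
  obtain ⟨C2, hC2⟩ := hGO
  set C : ℝ := max (max C1 C2) 0
  have hC0 : 0 ≤ C := le_max_right _ _
  have hGpow : ∀ k : ℕ, G ((2:ℝ) ^ k)⁻¹ ^ (2 ^ k) = NormedSpace.exp (A + B) := by
    intro k
    let : NormedAlgebra ℚ R := NormedAlgebra.restrictScalars ℚ ℝ R
    simp only [hG]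
    rw [← NormedSpace.exp_nsmul, ← Nat.cast_smul_eq_nsmul ℝ, smul_smul]
    simp
  have hd : Tendsto (fun k : ℕ => (2:ℝ) ^ k * ‖F ((2:ℝ) ^ k)⁻¹ - G ((2:ℝ) ^ k)⁻¹‖) atTop (𝓝 0) := by
    have h := hF'.sub hG'
    rw [sub_self, hasDerivAt_iff_isLittleO] at h
    have h2 : (fun t => F t - G t) =o[𝓝 0] fun t : ℝ => t := by
      simpa [hF0, hG0] using h
    have h3 := (h2.comp_tendsto hlim).norm_left.tendsto_div_nhds_zero
    refine h3.congr fun k => ?_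
    simp [div_eq_mul_inv, mul_comm]
  rw [tendsto_iff_norm_sub_tendsto_zero]
  have hd2 := hd.const_mul (Real.exp C)
  rw [mul_zero] at hd2
  refine squeeze_zero' (Eventually.of_forall fun _ => norm_nonneg _) ?_ hd2
  filter_upwards [hC1, hC2] with k h1 h2
  have hp : (0:ℝ) < ((2:ℝ) ^ k)⁻¹ := by positivity
  set M : ℝ := 1 + C * ((2:ℝ) ^ k)⁻¹
  have hM : 1 ≤ M := by
    have := mul_nonneg hC0 hp.le
    simp only [M]; linarith
  have nb : ∀ X : R, ∀ c, c ≤ C → ‖X - 1‖ ≤ c * ((2:ℝ) ^ k)⁻¹ → ‖X‖ ≤ M := by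
    intro X c hc hX
    have : ‖X‖ ≤ ‖X - 1‖ + ‖(1:R)‖ := by
      simpa using norm_add_le (X - 1) 1
    rw [norm_one] at this
    have h3 := mul_le_mul_of_nonneg_right hc hp.le
    simp only [M]; linarith
  have hb := aux_pow_sub (F ((2:ℝ) ^ k)⁻¹) (G ((2:ℝ) ^ k)⁻¹) M hM
    (nb _ C1 ((le_max_left _ _).trans (le_max_left _ _)) h1)
    (nb _ C2 ((le_max_right _ _).trans (le_max_left _ _)) h2) (2 ^ k)
  rw [hGpow] at hb
  have hMp : M ^ (2 ^ k) ≤ Real.exp C := by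
    have : M ≤ Real.exp (C * ((2:ℝ) ^ k)⁻¹) := by
      have := Real.add_one_le_exp (C * ((2:ℝ) ^ k)⁻¹)
      simp only [M]; linarith
    calc M ^ (2^k) ≤ Real.exp (C * ((2:ℝ) ^ k)⁻¹) ^ (2^k) := pow_le_pow_left₀ (by linarith) this _
      _ = Real.exp C := by
        rw [← Real.exp_nat_mul]; congr 1; push_cast; field_simp
  refine hb.trans ?_
  push_cast
  calc (2:ℝ) ^ k * M ^ 2 ^ k * ‖F ((2:ℝ) ^ k)⁻¹ - G ((2:ℝ) ^ k)⁻¹‖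
      ≤ (2:ℝ) ^ k * Real.exp C * ‖F ((2:ℝ) ^ k)⁻¹ - G ((2:ℝ) ^ k)⁻¹‖ := by gcongr
    _ = _ := by ring

/-- `tr (P Q) ≤ (tr P² + tr Q²)/2` for symmetric matrices, in transposed form. -/
lemma aux_trace_two {n : ℕ} (P Q : Matrix (Fin n) (Fin n) ℝ) :
    2 * (P * Qᵀ).trace ≤ (P * Pᵀ).trace + (Q * Qᵀ).trace := by
  have h : 0 ≤ ((P - Q) * (P - Q)ᵀ).trace := by
    simpa using (posSemidef_self_mul_conjTranspose (P - Q)).trace_nonneg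
  have e : (Q * Pᵀ).trace = (P * Qᵀ).trace := by
    rw [← trace_transpose]; simp
  simp only [transpose_sub, sub_mul, mul_sub, trace_sub] at h
  linarith

lemma aux_trace_mul_pow {n : ℕ} (P Q : Matrix (Fin n) (Fin n) ℝ) (k : ℕ) :
    ((P * Q) ^ k).trace = ((Q * P) ^ k).trace := by
  cases k with
  | zero => simp
  | succ k =>
    have : (P * Q) ^ (k+1) = P * ((Q * P) ^ k * Q) := by
      rw [pow_succ', mul_assoc, ← mul_assoc, mul_assoc]
      congr 1
      induction k with
      | zero => simp
      | succ k ih =>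
        rw [pow_succ' (P * Q), pow_succ' (Q * P)]
        calc Q * (P * Q * (P * Q) ^ k) = Q * P * (Q * (P * Q) ^ k) := by noncomm_ring
          _ = _ := by rw [ih]; noncomm_ring
    rw [this, trace_mul_comm, mul_assoc, ← pow_succ]

/-- From the one-matrix trace inequality at levels `< k`, the two-matrix inequality at level `k`. -/
lemma aux_two_of_one {n : ℕ} (k : ℕ)
    (h : ∀ i < k, ∀ M : Matrix (Fin n) (Fin n) ℝ,
      (M ^ (2 ^ (i+1))).trace ≤ ((M * Mᵀ) ^ (2 ^ i)).trace) :
    ∀ X Y : Matrix (Fin n) (Fin n) ℝ, Xᵀ = X → Yᵀ = Y →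
      ((X * Y) ^ (2 ^ k)).trace ≤ (X ^ (2 ^ k) * Y ^ (2 ^ k)).trace := by
  induction k with
  | zero => intro X Y _ _; simp
  | succ k ih =>
    intro X Y hX hY
    have h1 := h k (Nat.lt_succ_self k) (X * Y)
    have e : X * Y * (X * Y)ᵀ = X * (Y * Y * X) := by
      rw [transpose_mul, hX, hY]; noncomm_ring
    rw [e, aux_trace_mul_pow X (Y * Y * X)] at h1
    have e2 : Y * Y * X * X = (Y * Y) * (X * X) := by noncomm_ring
    rw [e2, aux_trace_mul_pow (Y * Y)] at h1
    refine h1.trans ((ih (fun i hi => h i (hi.trans (Nat.lt_succ_self k))) (X * X) (Y * Y)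
      (by simp [hX]) (by simp [hY])).trans (le_of_eq ?_))
    rw [← pow_two, ← pow_two, ← pow_mul, ← pow_mul, pow_succ 2 k, mul_comm 2]

lemma aux_one {n : ℕ} (k : ℕ) : ∀ M : Matrix (Fin n) (Fin n) ℝ,
      (M ^ (2 ^ (k+1))).trace ≤ ((M * Mᵀ) ^ (2 ^ k)).trace := by
  induction k using Nat.strong_induction_on with
  | _ k ih =>
    intro M
    cases k with
    | zero =>
      have h := aux_trace_two M Mᵀ
      rw [transpose_transpose, trace_mul_comm Mᵀ M] at h
      simp only [zero_add, pow_one, pow_zero]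
      rw [pow_two]; linarith
    | succ k =>
      have h1 := ih k (Nat.lt_succ_self k) (M * M)
      have e0 : (M * M) ^ (2 ^ (k+1)) = M ^ (2 ^ (k+1+1)) := by
        rw [← pow_two, ← pow_mul, pow_succ 2 (k+1), mul_comm]
      have e1 : M * M * (M * M)ᵀ = M * (M * Mᵀ * Mᵀ) := by
        rw [transpose_mul]; noncomm_ring
      have e2 : M * Mᵀ * Mᵀ * M = (M * Mᵀ) * (Mᵀ * M) := by noncomm_ring
      rw [e0, e1, aux_trace_mul_pow M (M * Mᵀ * Mᵀ), e2] at h1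
      have h2 := aux_two_of_one k (fun i hi => ih i (hi.trans (Nat.lt_succ_self k)))
        (M * Mᵀ) (Mᵀ * M) (by simp) (by simp)
      have h3 := aux_trace_two ((M * Mᵀ) ^ (2 ^ k)) ((Mᵀ * M) ^ (2 ^ k))
      simp only [transpose_pow, transpose_mul, transpose_transpose, ← pow_add] at h3
      have e3 : 2 ^ k + 2 ^ k = 2 ^ (k+1) := by ring
      rw [e3, aux_trace_mul_pow Mᵀ M] at h3
      linarith

open Filter Topology in
open scoped Matrix.Norms.L2Operator in
/-- The Golden–Thompson inequality for real symmetric matrices. -/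
lemma aux_golden_thompson {n : ℕ} [NeZero n] (A B : Matrix (Fin n) (Fin n) ℝ)
    (hA : Aᵀ = A) (hB : Bᵀ = B) :
    (NormedSpace.exp (A + B)).trace ≤ (NormedSpace.exp A * NormedSpace.exp B).trace := by
  have ht := aux_trotter A B
  have hc : Continuous fun M : Matrix (Fin n) (Fin n) ℝ => M.trace := by
    simp only [Matrix.trace, Matrix.diag]; fun_prop
  have ht2 := (hc.tendsto _).comp ht
  refine le_of_tendsto ht2 (Eventually.of_forall fun k => ?_)
  have hp : ∀ C : Matrix (Fin n) (Fin n) ℝ,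
      NormedSpace.exp ((((2:ℝ) ^ k)⁻¹) • C) ^ (2 ^ k) = NormedSpace.exp C := by
    intro C
    rw [← Matrix.exp_nsmul, ← Nat.cast_smul_eq_nsmul ℝ, smul_smul]
    simp
  have h := aux_two_of_one k (fun i _ => aux_one i) (NormedSpace.exp ((((2:ℝ) ^ k)⁻¹) • A))
    (NormedSpace.exp ((((2:ℝ) ^ k)⁻¹) • B))
    (by rw [← Matrix.exp_transpose]; simp [hA]) (by rw [← Matrix.exp_transpose]; simp [hB])
  rw [hp, hp] at h
  exact h

lemma aux_spectral {n : ℕ} (K : Matrix (Fin n) (Fin n) ℝ) (hK : Kᵀ = K) :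
    ∃ (U : Matrix (Fin n) (Fin n) ℝ) (l : Fin n → ℝ), U * Uᵀ = 1 ∧ Uᵀ * U = 1 ∧
      K = U * diagonal l * Uᵀ ∧
      ∀ θ : ℝ, NormedSpace.exp (θ • K) = U * diagonal (fun i => Real.exp (θ * l i)) * Uᵀ := by
  have hH : K.IsHermitian := by
    rw [Matrix.IsHermitian, conjTranspose_eq_transpose_of_trivial, hK]
  set U : Matrix (Fin n) (Fin n) ℝ := hH.eigenvectorUnitary.1 with hU
  have h1 : U * Uᵀ = 1 := by
    have : U * star U = 1 := Unitary.coe_mul_star_self hH.eigenvectorUnitary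
    rwa [star_eq_conjTranspose, conjTranspose_eq_transpose_of_trivial] at this
  have h2 : Uᵀ * U = 1 := by
    have : star U * U = 1 := Unitary.coe_star_mul_self hH.eigenvectorUnitary
    rwa [star_eq_conjTranspose, conjTranspose_eq_transpose_of_trivial] at this
  have h3 : K = U * diagonal hH.eigenvalues * Uᵀ := by
    have := hH.spectral_theorem
    rw [Unitary.conjStarAlgAut_apply, star_eq_conjTranspose,
      conjTranspose_eq_transpose_of_trivial] at this
    exact this
  refine ⟨U, hH.eigenvalues, h1, h2, h3, fun θ => ?_⟩
  have hinv : U⁻¹ = Uᵀ := Matrix.inv_eq_right_inv h1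
  have hu : IsUnit U := ⟨⟨U, Uᵀ, h1, h2⟩, rfl⟩
  have e : θ • K = U * diagonal (fun i => θ * hH.eigenvalues i) * U⁻¹ := by
    conv_lhs => rw [h3]
    rw [hinv, ← smul_mul_assoc, ← mul_smul_comm, ← diagonal_smul]
    rfl
  rw [e, Matrix.exp_conj _ _ hu, Matrix.exp_diagonal, hinv]
  congr 3
  ext i
  rw [Pi.coe_exp, Real.exp_eq_exp_ℝ]

lemma aux_conj_diag_psd {n : ℕ} (U : Matrix (Fin n) (Fin n) ℝ) (l : Fin n → ℝ) (hl : ∀ i, 0 ≤ l i) :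
    (U * diagonal l * Uᵀ).PosSemidef := by
  have := (PosSemidef.diagonal (d := l) hl).mul_mul_conjTranspose_same U
  rwa [conjTranspose_eq_transpose_of_trivial] at this

lemma aux_trace_mul_nonneg {n : ℕ} (P Q : Matrix (Fin n) (Fin n) ℝ) (hP : P.PosSemidef)
    (hQ : Q.PosSemidef) : 0 ≤ (P * Q).trace := by
  have hPt : Pᵀ = P := by
    have := hP.isHermitian.eq
    rwa [conjTranspose_eq_transpose_of_trivial] at this
  obtain ⟨U, l, h1, h2, h3, -⟩ := aux_spectral P hPt
  have hl : ∀ i, 0 ≤ l i := by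
    have := hP.conjTranspose_mul_mul_same U
    rw [conjTranspose_eq_transpose_of_trivial] at this
    have e : Uᵀ * P * U = diagonal l := by
      rw [h3]
      calc Uᵀ * (U * diagonal l * Uᵀ) * U = (Uᵀ * U) * diagonal l * (Uᵀ * U) := by noncomm_ring
        _ = _ := by rw [h2]; simp
    rw [e, posSemidef_diagonal_iff] at this
    exact this
  have hQ2 := hQ.conjTranspose_mul_mul_same U
  rw [conjTranspose_eq_transpose_of_trivial] at hQ2
  have : (P * Q).trace = (diagonal l * (Uᵀ * Q * U)).trace := by
    rw [h3]
    calc (U * diagonal l * Uᵀ * Q).trace = (U * (diagonal l * (Uᵀ * Q))).trace := by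
          congr 1; noncomm_ring
      _ = (diagonal l * (Uᵀ * Q) * U).trace := by rw [trace_mul_comm]
      _ = _ := by congr 1; noncomm_ring
  rw [this, Matrix.trace]
  refine Finset.sum_nonneg fun i _ => ?_
  rw [diag_apply, diagonal_mul]
  exact mul_nonneg (hl i) hQ2.diag_nonneg

lemma aux_exp_psd {n : ℕ} (K : Matrix (Fin n) (Fin n) ℝ) (hK : Kᵀ = K) :
    (NormedSpace.exp K).PosSemidef := by
  obtain ⟨U, l, h1, h2, h3, h4⟩ := aux_spectral K hK
  have := h4 1
  rw [one_smul] at this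
  rw [this]
  exact aux_conj_diag_psd U _ fun i => (Real.exp_pos _).le

/-- Convexity bound for the exponential on `[0, 1/L]`. -/
lemma aux_exp_chord (θ L x : ℝ) (hL : 0 < L) (hx : 0 ≤ x) (hxL : x * L ≤ 1) :
    Real.exp (θ * x) ≤ 1 + (L * (Real.exp (θ / L) - 1)) * x := by
  have h := convexOn_exp.2 (Set.mem_univ 0) (Set.mem_univ (θ / L))
    (show 0 ≤ 1 - x * L by linarith) (show 0 ≤ x * L by positivity) (by ring)
  simp only [smul_eq_mul, mul_zero, zero_add, Real.exp_zero, mul_one] at h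
  have e : x * L * (θ / L) = θ * x := by field_simp
  rw [e] at h
  linarith

lemma aux_chord_psd {n : ℕ} (K : Matrix (Fin n) (Fin n) ℝ) (hK : K.PosSemidef) (θ L : ℝ)
    (hL : 0 < L) (htr : K.trace * L ≤ 1) :
    (1 + (L * (Real.exp (θ / L) - 1)) • K - NormedSpace.exp (θ • K)).PosSemidef := by
  have hKt : Kᵀ = K := by
    have := hK.isHermitian.eq
    rwa [conjTranspose_eq_transpose_of_trivial] at this
  obtain ⟨U, l, h1, h2, h3, h4⟩ := aux_spectral K hKt
  have hl : ∀ i, 0 ≤ l i := by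
    have := hK.conjTranspose_mul_mul_same U
    rw [conjTranspose_eq_transpose_of_trivial] at this
    have e : Uᵀ * K * U = diagonal l := by
      rw [h3]
      calc Uᵀ * (U * diagonal l * Uᵀ) * U = (Uᵀ * U) * diagonal l * (Uᵀ * U) := by noncomm_ring
        _ = _ := by rw [h2]; simp
    rw [e, posSemidef_diagonal_iff] at this
    exact this
  have htr2 : K.trace = ∑ i, l i := by
    rw [h3, mul_assoc, trace_mul_comm, mul_assoc, h2, mul_one, trace_diagonal]
  set c := L * (Real.exp (θ / L) - 1)
  have e : 1 + c • K - NormedSpace.exp (θ • K)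
      = U * diagonal (fun i => 1 + c * l i - Real.exp (θ * l i)) * Uᵀ := by
    have ed : diagonal (fun i => 1 + c * l i - Real.exp (θ * l i))
        = 1 + c • diagonal l - diagonal (fun i => Real.exp (θ * l i)) := by
      ext i j
      by_cases hij : i = j
      · subst hij; simp
      · simp [hij]
    rw [h4 θ, ed, mul_sub, sub_mul, mul_add, add_mul, mul_one, h1, mul_smul_comm, smul_mul_assoc,
      ← h3]
  rw [e]
  refine aux_conj_diag_psd U _ fun i => ?_
  have hi : l i ≤ K.trace := by
    rw [htr2]; exact Finset.single_le_sum (fun j _ => hl j) (Finset.mem_univ i)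
  have := aux_exp_chord θ L (l i) hL (hl i) ((mul_le_mul_of_nonneg_right hi hL.le).trans htr)
  linarith

lemma aux_exp_trace_ge {n : ℕ} (K : Matrix (Fin n) (Fin n) ℝ) (hK : Kᵀ = K) (s : ℝ)
    (z : Fin n → ℝ) (hz : s * (z ⬝ᵥ z) < z ⬝ᵥ (K *ᵥ z)) :
    Real.exp s ≤ (NormedSpace.exp K).trace := by
  obtain ⟨U, l, h1, h2, h3, h4⟩ := aux_spectral K hK
  have h5 := h4 1
  rw [one_smul] at h5
  have htr2 : (NormedSpace.exp K).trace = ∑ i, Real.exp (l i) := by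
    rw [h5, mul_assoc, trace_mul_comm, mul_assoc, h2, mul_one, trace_diagonal]
    simp
  by_contra hcon
  have hl : ∀ i, l i ≤ s := by
    intro i
    by_contra hi
    apply hcon
    rw [htr2]
    refine le_trans (Real.exp_le_exp.2 (not_le.1 hi).le) ?_
    exact Finset.single_le_sum (f := fun j => Real.exp (l j))
      (fun j _ => (Real.exp_pos _).le) (Finset.mem_univ i)
  have hp : (s • (1 : Matrix (Fin n) (Fin n) ℝ) - K).PosSemidef := by
    have e : s • (1 : Matrix (Fin n) (Fin n) ℝ) - K = U * diagonal (fun i => s - l i) * Uᵀ := by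
      have ed : diagonal (fun i => s - l i) = s • (1 : Matrix (Fin n) (Fin n) ℝ) - diagonal l := by
        ext i j
        by_cases hij : i = j
        · subst hij; simp
        · simp [hij]
      rw [ed, mul_sub, sub_mul, mul_smul_comm, mul_one, smul_mul_assoc, h1, ← h3]
    rw [e]
    exact aux_conj_diag_psd U _ fun i => sub_nonneg.2 (hl i)
  have := hp.dotProduct_mulVec_nonneg z
  rw [sub_mulVec, smul_mulVec, one_mulVec, dotProduct_sub, dotProduct_smul] at this
  simp only [star_trivial, smul_eq_mul] at this
  linarith

/-- Matrix Chernoff, moment generating function bound, by induction on the number of samples. -/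
lemma aux_mgf {n m : ℕ} [NeZero n] (q : Fin m → ℝ) (hq : ∀ j, 0 ≤ q j) (hsum : ∑ j, q j = 1)
    (X : Fin m → Matrix (Fin n) (Fin n) ℝ) (hX : ∀ j, (X j).PosSemidef) (L δ θ : ℝ) (hL : 0 < L)
    (htr : ∀ j, (X j).trace * L ≤ 1) (hE : ∑ j, q j • X j = δ • (1 : Matrix (Fin n) (Fin n) ℝ))
    (k : ℕ) : ∀ H : Matrix (Fin n) (Fin n) ℝ, Hᵀ = H →
    ∑ ω : Fin k → Fin m, (∏ i, q (ω i)) * (NormedSpace.exp (H + θ • ∑ i, X (ω i))).trace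
      ≤ Real.exp (L * (Real.exp (θ / L) - 1) * δ) ^ k * (NormedSpace.exp H).trace := by
  set c := L * (Real.exp (θ / L) - 1) with hc
  have hXt : ∀ j, (X j)ᵀ = X j := by
    intro j
    have := (hX j).isHermitian.eq
    rwa [conjTranspose_eq_transpose_of_trivial] at this
  induction k with
  | zero => intro H hH; simp
  | succ k ih =>
    intro H hH
    rw [← (Fin.consEquiv (fun _ : Fin (k+1) => Fin m)).sum_comp, Fintype.sum_prod_type]
    have step : ∀ j, ∑ ω : Fin k → Fin m,
        (∏ i, q ((Fin.consEquiv (fun _ : Fin (k+1) => Fin m)) (j, ω) i)) *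
        (NormedSpace.exp (H + θ • ∑ i, X ((Fin.consEquiv (fun _ : Fin (k+1) => Fin m)) (j, ω) i))).trace
        ≤ q j * (Real.exp (c * δ) ^ k * (NormedSpace.exp H * (1 + c • X j)).trace) := by
      intro j
      have h1 := ih (H + θ • X j) (by simp [hH, hXt])
      have e : ∑ ω : Fin k → Fin m,
          (∏ i, q ((Fin.consEquiv (fun _ : Fin (k+1) => Fin m)) (j, ω) i)) *
          (NormedSpace.exp (H + θ • ∑ i, X ((Fin.consEquiv (fun _ : Fin (k+1) => Fin m)) (j, ω) i))).trace
          = q j * ∑ ω : Fin k → Fin m, (∏ i, q (ω i)) *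
            (NormedSpace.exp (H + θ • X j + θ • ∑ i, X (ω i))).trace := by
        rw [Finset.mul_sum]
        refine Finset.sum_congr rfl fun ω _ => ?_
        simp only [Fin.consEquiv_apply, Fin.prod_univ_succ, Fin.sum_univ_succ, Fin.cons_zero,
          Fin.cons_succ, smul_add, ← add_assoc, mul_assoc]
      rw [e]
      refine mul_le_mul_of_nonneg_left (h1.trans ?_) (hq j)
      refine mul_le_mul_of_nonneg_left ?_ (by positivity)
      refine (aux_golden_thompson H (θ • X j) hH (by simp [hXt])).trans ?_
      have h2 := aux_trace_mul_nonneg _ _ (aux_exp_psd H hH) (aux_chord_psd (X j) (hX j) θ L hL (htr j))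
      rw [mul_sub, trace_sub] at h2
      linarith
    refine (Finset.sum_le_sum fun j _ => step j).trans ?_
    have e2 : ∑ j, q j * (Real.exp (c * δ) ^ k * (NormedSpace.exp H * (1 + c • X j)).trace)
        = Real.exp (c * δ) ^ k * ((1 + c * δ) * (NormedSpace.exp H).trace) := by
      have e3 : ∑ j, q j * (NormedSpace.exp H * X j).trace = δ * (NormedSpace.exp H).trace := by
        have := congrArg (fun M => (NormedSpace.exp H * M).trace) hE
        simpa [Finset.mul_sum, trace_sum] using this
      calc _ = Real.exp (c * δ) ^ k * ((∑ j, q j) * (NormedSpace.exp H).trace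
                + c * ∑ j, q j * (NormedSpace.exp H * X j).trace) := by
            rw [Finset.sum_mul, Finset.mul_sum, ← Finset.sum_add_distrib, Finset.mul_sum]
            refine Finset.sum_congr rfl fun j _ => ?_
            rw [mul_add, trace_add, mul_one, mul_smul_comm, trace_smul, smul_eq_mul]
            ring
        _ = _ := by rw [hsum, e3]; ring
    rw [e2, pow_succ, mul_assoc (Real.exp (c * δ) ^ k)]
    have hpk : 0 ≤ Real.exp (c * δ) ^ k := by positivity
    refine mul_le_mul_of_nonneg_left ?_ hpk
    have ht : 0 ≤ (NormedSpace.exp H).trace := (aux_exp_psd H hH).trace_nonneg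
    refine mul_le_mul_of_nonneg_right ?_ ht
    have := Real.add_one_le_exp (c * δ)
    linarith

lemma aux_scalar_lt (ε : ℝ) (h0 : 0 < ε) : ε < (1 + ε) * Real.log (1 + ε) := by
  have h := Real.log_lt_sub_one_of_pos (x := (1 + ε)⁻¹) (by positivity)
    (by intro h; rw [inv_eq_one] at h; linarith)
  rw [Real.log_inv] at h
  have h1 : 0 < 1 + ε := by linarith
  have h2 := mul_lt_mul_of_pos_left h h1
  have h3 : (1 + ε) * ((1 + ε)⁻¹ - 1) = -ε := by field_simp; ring
  rw [h3] at h2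
  linarith

lemma aux_scalar_lower (ε : ℝ) (h0 : 0 < ε) (h1 : ε < 1) :
    -ε - (1 - ε) * Real.log (1 - ε) ≤ ε - (1 + ε) * Real.log (1 + ε) := by
  set f : ℝ → ℝ := fun x => 2 * x + (1 - x) * Real.log (1 - x) - (1 + x) * Real.log (1 + x) with hf
  have hd : ∀ x ∈ Set.Icc 0 ε, HasDerivAt f (-Real.log (1 - x) - Real.log (1 + x)) x := by
    intro x hx
    have hx1 : 1 - x ≠ 0 := by have := hx.2; linarith
    have hx2 : 1 + x ≠ 0 := by have := hx.1; linarith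
    have a1 : HasDerivAt (fun x : ℝ => 1 - x) (-1) x := by
      simpa using (hasDerivAt_id x).const_sub 1
    have a2 : HasDerivAt (fun x : ℝ => 1 + x) 1 x := by
      simpa using (hasDerivAt_id x).const_add 1
    have a3 := (((hasDerivAt_id x).const_mul 2).add (a1.mul (a1.log hx1))).sub (a2.mul (a2.log hx2))
    refine HasDerivAt.congr_deriv (f := f) a3 ?_
    field_simp
    ring
  have hm : MonotoneOn f (Set.Icc 0 ε) := by
    refine monotoneOn_of_deriv_nonneg (convex_Icc 0 ε)
      (fun x hx => (hd x hx).continuousAt.continuousWithinAt)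
      (fun x hx => (hd x (interior_subset hx)).differentiableAt.differentiableWithinAt) ?_
    intro x hx
    have hx' := interior_subset hx
    rw [(hd x hx').deriv]
    have p1 : 0 < 1 - x := by have := hx'.2; linarith
    have p2 : 0 < 1 + x := by have := hx'.1; linarith
    have : Real.log ((1 - x) * (1 + x)) ≤ 0 :=
      Real.log_nonpos (by positivity) (by nlinarith [sq_nonneg x])
    rw [Real.log_mul p1.ne' p2.ne'] at this
    linarith
  have := hm (Set.left_mem_Icc.2 h0.le) (Set.right_mem_Icc.2 h0.le) h0.le
  simp only [hf] at this
  simp at this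
  linarith

/-- Tail bound as a finite weighted sum. -/
lemma aux_tail {n m d : ℕ} [NeZero n] (hd : 1 ≤ d) (q : Fin m → ℝ) (hq : ∀ j, 0 ≤ q j)
    (hsum : ∑ j, q j = 1)
    (X : Fin m → Matrix (Fin n) (Fin n) ℝ) (hX : ∀ j, (X j).PosSemidef) (L : ℝ) (hL : 0 < L)
    (htr : ∀ j, (X j).trace * L ≤ 1)
    (hE : ∑ j, q j • X j = ((d:ℝ)⁻¹) • (1 : Matrix (Fin n) (Fin n) ℝ))
    (ε : ℝ) (h0 : 0 < ε) (h1 : ε < 1) (S : Finset (Fin d → Fin m))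
    (hS : ∀ ω ∈ S, ∃ z : Fin n → ℝ, z ⬝ᵥ ((∑ i, X (ω i)) *ᵥ z) < (1 - ε) * (z ⬝ᵥ z) ∨
      (1 + ε) * (z ⬝ᵥ z) < z ⬝ᵥ ((∑ i, X (ω i)) *ᵥ z)) :
    ∑ ω ∈ S, ∏ i, q (ω i) ≤ 2 * n * Real.exp (L * (ε - (1 + ε) * Real.log (1 + ε))) := by
  have hd0 : (d:ℝ) ≠ 0 := by positivity
  have hXt : ∀ j, (X j)ᵀ = X j := by
    intro j
    have := (hX j).isHermitian.eq
    rwa [conjTranspose_eq_transpose_of_trivial] at this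
  have mgf : ∀ θ : ℝ, ∑ ω : Fin d → Fin m, (∏ i, q (ω i)) *
      (NormedSpace.exp (θ • ∑ i, X (ω i))).trace ≤ Real.exp (L * (Real.exp (θ / L) - 1)) * n := by
    intro θ
    have h := aux_mgf q hq hsum X hX L (d:ℝ)⁻¹ θ hL htr hE d 0 (by simp)
    rw [← Real.exp_nat_mul] at h
    have e : (d:ℝ) * (L * (Real.exp (θ / L) - 1) * (d:ℝ)⁻¹) = L * (Real.exp (θ / L) - 1) := by
      field_simp
    rw [e] at h
    simpa [NormedSpace.exp_zero] using h
  set t1 := L * Real.log (1 + ε) with ht1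
  set t2 := L * Real.log (1 - ε) with ht2
  have hlog1 : 0 < Real.log (1 + ε) := Real.log_pos (by linarith)
  have hlog2 : Real.log (1 - ε) < 0 := Real.log_neg (by linarith) (by linarith)
  have pt1 : 0 < t1 := mul_pos hL hlog1
  have pt2 : t2 < 0 := mul_neg_of_pos_of_neg hL hlog2
  have m1 := mgf t1
  have m2 := mgf t2
  have e1 : Real.exp (t1 / L) = 1 + ε := by
    rw [ht1, mul_div_cancel_left₀ _ hL.ne', Real.exp_log (by linarith)]
  have e2 : Real.exp (t2 / L) = 1 - ε := by
    rw [ht2, mul_div_cancel_left₀ _ hL.ne', Real.exp_log (by linarith)]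
  rw [e1] at m1
  rw [e2] at m2
  have hw : ∀ ω : Fin d → Fin m, 0 ≤ ∏ i, q (ω i) := fun ω => Finset.prod_nonneg fun i _ => hq _
  have hKt : ∀ (θ : ℝ) (ω : Fin d → Fin m), (θ • ∑ i, X (ω i))ᵀ = θ • ∑ i, X (ω i) := by
    intro θ ω
    simp [transpose_sum, hXt]
  have htn : ∀ (θ : ℝ) (ω : Fin d → Fin m), 0 ≤ (NormedSpace.exp (θ • ∑ i, X (ω i))).trace :=
    fun θ ω => (aux_exp_psd _ (hKt θ ω)).trace_nonneg
  set F : (Fin d → Fin m) → ℝ := fun ω =>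
    Real.exp (-(t1 * (1 + ε))) * ((∏ i, q (ω i)) * (NormedSpace.exp (t1 • ∑ i, X (ω i))).trace)
    + Real.exp (-(t2 * (1 - ε))) * ((∏ i, q (ω i)) * (NormedSpace.exp (t2 • ∑ i, X (ω i))).trace)
    with hF
  have n1 : ∀ ω : Fin d → Fin m, 0 ≤ Real.exp (-(t1 * (1 + ε))) *
      ((∏ i, q (ω i)) * (NormedSpace.exp (t1 • ∑ i, X (ω i))).trace) := fun ω =>
    mul_nonneg (Real.exp_pos _).le (mul_nonneg (hw ω) (htn _ ω))
  have n2 : ∀ ω : Fin d → Fin m, 0 ≤ Real.exp (-(t2 * (1 - ε))) *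
      ((∏ i, q (ω i)) * (NormedSpace.exp (t2 • ∑ i, X (ω i))).trace) := fun ω =>
    mul_nonneg (Real.exp_pos _).le (mul_nonneg (hw ω) (htn _ ω))
  have key : ∀ (θ s : ℝ) (ω : Fin d → Fin m) (z : Fin n → ℝ),
      s * (z ⬝ᵥ z) < z ⬝ᵥ ((θ • ∑ i, X (ω i)) *ᵥ z) → ∏ i, q (ω i) ≤ Real.exp (-s) *
      ((∏ i, q (ω i)) * (NormedSpace.exp (θ • ∑ i, X (ω i))).trace) := by
    intro θ s ω z hz
    have h := aux_exp_trace_ge _ (hKt θ ω) s z hz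
    have h2 : 1 ≤ Real.exp (-s) * (NormedSpace.exp (θ • ∑ i, X (ω i))).trace := by
      calc (1:ℝ) = Real.exp (-s) * Real.exp s := by rw [← Real.exp_add]; simp
        _ ≤ _ := mul_le_mul_of_nonneg_left h (Real.exp_pos _).le
    nlinarith [mul_le_mul_of_nonneg_left h2 (hw ω)]
  have hle : ∀ ω ∈ S, ∏ i, q (ω i) ≤ F ω := by
    intro ω hω
    obtain ⟨z, hz | hz⟩ := hS ω hω
    · have := key t2 (t2 * (1 - ε)) ω z (by
        rw [smul_mulVec, dotProduct_smul, smul_eq_mul, mul_assoc]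
        exact mul_lt_mul_of_neg_left hz pt2)
      have := n1 ω
      simp only [hF]; linarith
    · have := key t1 (t1 * (1 + ε)) ω z (by
        rw [smul_mulVec, dotProduct_smul, smul_eq_mul, mul_assoc]
        exact mul_lt_mul_of_pos_left hz pt1)
      have := n2 ω
      simp only [hF]; linarith
  have hFn : ∀ ω, 0 ≤ F ω := fun ω => add_nonneg (n1 ω) (n2 ω)
  have hn0 : (0:ℝ) ≤ n := Nat.cast_nonneg n
  calc ∑ ω ∈ S, ∏ i, q (ω i) ≤ ∑ ω ∈ S, F ω := Finset.sum_le_sum hle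
    _ ≤ ∑ ω, F ω := Finset.sum_le_univ_sum_of_nonneg hFn
    _ ≤ Real.exp (-(t1 * (1 + ε))) * (Real.exp (L * (1 + ε - 1)) * n)
        + Real.exp (-(t2 * (1 - ε))) * (Real.exp (L * (1 - ε - 1)) * n) := by
      simp only [hF]
      rw [Finset.sum_add_distrib, ← Finset.mul_sum, ← Finset.mul_sum]
      gcongr
    _ = Real.exp (L * (ε - (1 + ε) * Real.log (1 + ε))) * n
        + Real.exp (L * (-ε - (1 - ε) * Real.log (1 - ε))) * n := by
      rw [← mul_assoc, ← mul_assoc, ← Real.exp_add, ← Real.exp_add]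
      congr 3 <;> simp only [ht1, ht2] <;> ring
    _ ≤ Real.exp (L * (ε - (1 + ε) * Real.log (1 + ε))) * n
        + Real.exp (L * (ε - (1 + ε) * Real.log (1 + ε))) * n := by
      have := aux_scalar_lower ε h0 h1
      gcongr
    _ = _ := by ring

/-- Whitening of a full column rank matrix. -/
lemma aux_whiten {m n : ℕ} (A : Matrix (Fin m) (Fin n) ℝ) (hrank : A.rank = n) :
    ∃ (B : Matrix (Fin n) (Fin n) ℝ) (W : Matrix (Fin m) (Fin n) ℝ), W * B = A ∧ Wᵀ * W = 1 ∧
      ∀ j, W j ⬝ᵥ W j = lev A j := by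
  have hGt : (Aᵀ * A)ᵀ = Aᵀ * A := by simp
  have hG : (Aᵀ * A).PosSemidef := by
    have := posSemidef_conjTranspose_mul_self A
    rwa [conjTranspose_eq_transpose_of_trivial] at this
  have hu : IsUnit (Aᵀ * A) := by
    rw [← mulVec_surjective_iff_isUnit]
    have hr : (Aᵀ * A).rank = n := by rw [rank_transpose_mul_self, hrank]
    have htop : LinearMap.range (Aᵀ * A).mulVecLin = ⊤ := by
      apply Submodule.eq_top_of_finrank_eq
      rw [← Matrix.rank, hr]; simp
    exact LinearMap.range_eq_top.1 htop
  obtain ⟨U, l, h1, h2, h3, -⟩ := aux_spectral _ hGt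
  have hl : ∀ i, 0 ≤ l i := by
    have := hG.conjTranspose_mul_mul_same U
    rw [conjTranspose_eq_transpose_of_trivial] at this
    have e : Uᵀ * (Aᵀ * A) * U = diagonal l := by
      rw [h3]
      calc Uᵀ * (U * diagonal l * Uᵀ) * U = (Uᵀ * U) * diagonal l * (Uᵀ * U) := by noncomm_ring
        _ = _ := by rw [h2]; simp
    rw [e, posSemidef_diagonal_iff] at this
    exact this
  set B : Matrix (Fin n) (Fin n) ℝ := diagonal (fun i => Real.sqrt (l i)) * Uᵀ with hB
  have hBB : Bᵀ * B = Aᵀ * A := by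
    have e : diagonal (fun i => Real.sqrt (l i)) * diagonal (fun i => Real.sqrt (l i))
        = diagonal l := by
      rw [diagonal_mul_diagonal]; congr 1; ext i; exact Real.mul_self_sqrt (hl i)
    rw [h3, hB, transpose_mul, transpose_transpose, diagonal_transpose, ← e]
    noncomm_ring
  have hBu : IsUnit B.det := by
    have : IsUnit (Bᵀ * B).det := by rw [hBB]; exact (isUnit_iff_isUnit_det _).1 hu
    rw [det_mul] at this
    exact isUnit_of_mul_isUnit_right this
  clear_value B
  have hBtu : IsUnit (Bᵀ).det := by rwa [det_transpose]
  refine ⟨B, A * B⁻¹, ?_, ?_, ?_⟩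
  · rw [Matrix.mul_assoc, nonsing_inv_mul _ hBu, Matrix.mul_one]
  · rw [transpose_mul, transpose_nonsing_inv]
    calc (Bᵀ)⁻¹ * Aᵀ * (A * B⁻¹) = (Bᵀ)⁻¹ * (Aᵀ * A) * B⁻¹ := by simp only [Matrix.mul_assoc]
      _ = ((Bᵀ)⁻¹ * Bᵀ) * (B * B⁻¹) := by rw [← hBB]; simp only [Matrix.mul_assoc]
      _ = 1 := by rw [nonsing_inv_mul _ hBtu, mul_nonsing_inv _ hBu, Matrix.mul_one]
  · intro j
    have e1 : (A * B⁻¹) j ⬝ᵥ (A * B⁻¹) j = ((A * B⁻¹) * (A * B⁻¹)ᵀ) j j := rfl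
    have e2 : (A * B⁻¹) * (A * B⁻¹)ᵀ = A * ((Aᵀ * A)⁻¹ * Aᵀ) := by
      rw [← hBB, Matrix.mul_inv_rev, transpose_mul, transpose_nonsing_inv]
      simp only [Matrix.mul_assoc]
    rw [e1, e2]
    rfl

/-- Probability bound for the subspace-embedding property of a row-sampling sketch,
with rows sampled i.i.d. (product measure) from the distribution `q` on `{1,…,m}`,
together with the fact `exp ε < (1+ε)^(1+ε)` for `ε ∈ (0,1)`. -/
theorem row_sampling_embedding_probability {m n d : ℕ}
    (A : Matrix (Fin m) (Fin n) ℝ) (hrank : A.rank = n)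
    (q : Fin m → ℝ) (hq : ∀ j, 0 < q j) (hsum : (∑ j, q j) = 1)
    (hd : 1 ≤ d) (ε : ℝ) (hε : ε ∈ Set.Ioo (0 : ℝ) 1)
    (ρ : PMF (Fin m)) (hρ : ∀ j, ρ j = ENNReal.ofReal (q j))
    (r : ℝ)
    (hr : r = sInf {x : ℝ | ∃ j : Fin m, 0 < levDist A j ∧ x = q j / levDist A j}) :
    (Measure.pi fun _ : Fin d => ρ.toMeasure)
        {ω : Fin d → Fin m | ∃ x : Fin n → ℝ,
          ¬ ((1 - ε) * (∑ i, A.mulVec x i ^ 2)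
                ≤ (∑ i, (sampleMatrix q ω).mulVec (A.mulVec x) i ^ 2) ∧
             (∑ i, (sampleMatrix q ω).mulVec (A.mulVec x) i ^ 2)
                ≤ (1 + ε) * (∑ i, A.mulVec x i ^ 2))}
      ≤ ENNReal.ofReal
          (2 * (n : ℝ) * (Real.exp ε / (1 + ε) ^ (1 + ε)) ^ (r * d / n))
    ∧ Real.exp ε < (1 + ε) ^ (1 + ε) := by
  obtain ⟨h0, h1⟩ := hε
  have hp : (1 + ε) ^ (1 + ε) = Real.exp ((1 + ε) * Real.log (1 + ε)) := by
    rw [Real.rpow_def_of_pos (by linarith), mul_comm]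
  refine ⟨?_, by rw [hp]; exact Real.exp_lt_exp.2 (aux_scalar_lt ε h0)⟩
  have hbase : (Real.exp ε / (1 + ε) ^ (1 + ε)) ^ (r * d / n)
      = Real.exp (r * d / n * (ε - (1 + ε) * Real.log (1 + ε))) := by
    rw [hp, ← Real.exp_sub, ← Real.exp_mul, mul_comm]
  rw [hbase]
  set bad : Set (Fin d → Fin m) := {ω : Fin d → Fin m | ∃ x : Fin n → ℝ,
          ¬ ((1 - ε) * (∑ i, A.mulVec x i ^ 2)
                ≤ (∑ i, (sampleMatrix q ω).mulVec (A.mulVec x) i ^ 2) ∧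
             (∑ i, (sampleMatrix q ω).mulVec (A.mulVec x) i ^ 2)
                ≤ (1 + ε) * (∑ i, A.mulVec x i ^ 2))} with hbad
  rcases Nat.eq_zero_or_pos n with hn | hn
  · have : bad = ∅ := by
      ext ω
      simp only [hbad, Set.mem_ofPred_eq, Set.mem_empty_iff_false, iff_false]
      rintro ⟨x, hx⟩
      subst hn
      apply hx
      have : A *ᵥ x = 0 := by ext i; simp [mulVec, dotProduct]
      simp [this]
    rw [this]; simp
  have : NeZero n := ⟨hn.ne'⟩
  have hn1 : (1:ℝ) ≤ n := by exact_mod_cast hn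
  have hd1 : (1:ℝ) ≤ d := by exact_mod_cast hd
  rcases le_or_gt r 0 with hr0 | hr0
  · have hlt := aux_scalar_lt ε h0
    have : 0 ≤ r * d / n * (ε - (1 + ε) * Real.log (1 + ε)) := by
      refine mul_nonneg_of_nonpos_of_nonpos ?_ (by linarith)
      exact div_nonpos_of_nonpos_of_nonneg (mul_nonpos_of_nonpos_of_nonneg hr0 (by linarith))
        (by linarith)
    have h2 := Real.one_le_exp this
    refine prob_le_one.trans ?_
    rw [← ENNReal.ofReal_one]
    apply ENNReal.ofReal_le_ofReal
    nlinarith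
  obtain ⟨B, W, hWB, hWW, hlev⟩ := aux_whiten A hrank
  have hlev0 : ∀ j, 0 ≤ lev A j := by
    intro j; rw [← hlev j]
    exact Finset.sum_nonneg fun i _ => mul_self_nonneg _
  have hlevr : ∀ j, lev A j * r ≤ n * q j := by
    intro j
    rcases (hlev0 j).eq_or_lt with h | h
    · rw [← h, zero_mul]; exact mul_nonneg (by linarith) (hq j).le
    · have hld : 0 < levDist A j := div_pos h (by linarith)
      have hle : r ≤ q j / levDist A j := by
        rw [hr]
        refine csInf_le ⟨0, ?_⟩ ⟨j, hld, rfl⟩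
        rintro x ⟨i, hi, rfl⟩
        exact (div_pos (hq i) hi).le
      rw [le_div_iff₀ hld, levDist, ← mul_div_assoc, div_le_iff₀ (by linarith)] at hle
      linarith
  set X : Fin m → Matrix (Fin n) (Fin n) ℝ := fun j => (d * q j)⁻¹ • vecMulVec (W j) (W j) with hX
  have hdq : ∀ j, 0 < d * q j := fun j => mul_pos (by linarith) (hq j)
  have hXp : ∀ j, (X j).PosSemidef := by
    intro j
    have := posSemidef_vecMulVec_self_star (W j)
    rw [star_trivial] at this
    exact this.smul (inv_nonneg.2 (hdq j).le)
  set L : ℝ := r * d / n with hL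
  have hL0 : 0 < L := by positivity
  have htr : ∀ j, (X j).trace * L ≤ 1 := by
    intro j
    simp only [hX, trace_smul, trace_vecMulVec, smul_eq_mul, hlev]
    have h3 := hlevr j
    have hqj := hq j
    have e : (d * q j)⁻¹ * lev A j * L = lev A j * r / (n * q j) := by
      rw [hL]; field_simp
    rw [e]
    exact div_le_one_of_le₀ h3 (by positivity)
  have hE : ∑ j, q j • X j = ((d:ℝ)⁻¹) • (1 : Matrix (Fin n) (Fin n) ℝ) := by
    rw [← hWW]
    ext a b
    simp only [hX, Matrix.sum_apply, Matrix.smul_apply, vecMulVec_apply, smul_eq_mul, mul_apply,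
      transpose_apply, Finset.mul_sum]
    refine Finset.sum_congr rfl fun j _ => ?_
    have := (hq j).ne'
    field_simp
  have hmeas : (Measure.pi fun _ : Fin d => ρ.toMeasure) bad
      = ENNReal.ofReal (∑ ω ∈ bad.toFinite.toFinset, ∏ i, q (ω i)) := by
    rw [ENNReal.ofReal_sum_of_nonneg (fun ω _ => Finset.prod_nonneg fun i _ => (hq _).le)]
    conv_lhs => rw [← bad.toFinite.coe_toFinset]
    rw [← sum_measure_singleton]
    refine Finset.sum_congr rfl fun ω _ => ?_
    rw [Measure.pi_singleton, ENNReal.ofReal_prod_of_nonneg (fun i _ => (hq _).le)]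
    refine Finset.prod_congr rfl fun i _ => ?_
    rw [PMF.toMeasure_apply_singleton _ _ (measurableSet_singleton _), hρ]
  rw [hmeas]
  apply ENNReal.ofReal_le_ofReal
  refine aux_tail hd q (fun j => (hq j).le) hsum X hXp L hL0 htr hE ε h0 h1 _ ?_
  intro ω hω
  rw [Set.Finite.mem_toFinset] at hω
  obtain ⟨x, hx⟩ := hω
  refine ⟨B *ᵥ x, ?_⟩
  have hAx : A *ᵥ x = W *ᵥ (B *ᵥ x) := by rw [mulVec_mulVec, hWB]
  rw [hAx] at hx
  generalize B *ᵥ x = z at hx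
  have s1 : ∑ i, (W *ᵥ z) i ^ 2 = z ⬝ᵥ z := by
    have : (W *ᵥ z) ⬝ᵥ (W *ᵥ z) = z ⬝ᵥ z := by
      rw [dotProduct_mulVec, vecMul_mulVec, hWW, vecMul_one]
    rw [← this]
    simp [dotProduct, pow_two]
  have s2 : ∑ i, ((sampleMatrix q ω) *ᵥ (W *ᵥ z)) i ^ 2 = z ⬝ᵥ ((∑ i, X (ω i)) *ᵥ z) := by
    rw [sum_mulVec, dotProduct_sum]
    refine Finset.sum_congr rfl fun i _ => ?_
    have e1 : ((sampleMatrix q ω) *ᵥ (W *ᵥ z)) i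
        = 1 / Real.sqrt (d * q (ω i)) * (W *ᵥ z) (ω i) := by
      conv_lhs => rw [mulVec, dotProduct]
      simp [sampleMatrix]
    have e2 : (W *ᵥ z) (ω i) = W (ω i) ⬝ᵥ z := rfl
    rw [e1, e2, mul_pow, div_pow, one_pow, Real.sq_sqrt (hdq _).le]
    simp only [hX]
    rw [smul_mulVec, dotProduct_smul, vecMulVec_mulVec, smul_eq_mul]
    rw [op_smul_eq_smul, dotProduct_smul, smul_eq_mul, dotProduct_comm z]
    ring
  rw [s1, s2, not_and_or, not_le, not_le] at hx
  exact hx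
end

section
/- Let A be an m x n real matrix, epsilon >= 0, and let A-tilde be an m x n real matrix of rank k with ||A - A-tilde||_2 <= epsilon (spectral norm). Suppose A-tilde = A-tilde[:, J] X for some k x n matrix X and some index vector J of length k selecting columns. Then the column interpolative decomposition A-hat = A[:, J] X satisfies ||A - A-hat||_2 <= (1 + ||X||_2) epsilon. -/
/-- The spectral norm (largest singular value) of a real matrix, as the
`ℓ²→ℓ²` operator norm of the induced linear map between Euclidean spaces. -/
noncomputable def specNorm {m n : Type*} [Fintype m] [Fintype n] [DecidableEq n]
    (A : Matrix m n ℝ) : ℝ :=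
  ‖LinearMap.toContinuousLinearMap (Matrix.toEuclideanLin A)‖

open scoped Matrix.Norms.L2Operator in
theorem specNorm_eq_l2 {m n : ℕ} (A : Matrix (Fin m) (Fin n) ℝ) : specNorm A = ‖A‖ := rfl

theorem sel_injective {m n k : ℕ} (B : Matrix (Fin m) (Fin n) ℝ) (hrank : B.rank = k)
    (X : Matrix (Fin k) (Fin n) ℝ) (J : Fin k → Fin n)
    (hID : B = B.submatrix id J * X) : Function.Injective J := by
  have h1 : k ≤ (B.submatrix id J).rank := by
    have h0 := Matrix.rank_mul_le_left (B.submatrix id J) X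
    rw [← hID] at h0
    exact hrank.symm.le.trans h0
  have h2 : LinearIndependent ℝ (B.submatrix id J).col := by
    rw [linearIndependent_iff_card_le_finrank_span, Set.finrank,
      ← Matrix.rank_eq_finrank_span_cols]
    simpa using h1
  intro a b hab
  apply h2.injective
  ext i
  simp [Matrix.col, hab]

open scoped Matrix.Norms.L2Operator in
theorem sel_norm_le {n k : ℕ} (J : Fin k → Fin n) (hJ : Function.Injective J) :
    ‖(1 : Matrix (Fin n) (Fin n) ℝ).submatrix id J‖ ≤ 1 := by
  have h := Matrix.l2_opNorm_conjTranspose_mul_self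
    ((1 : Matrix (Fin n) (Fin n) ℝ).submatrix id J)
  have h2 : ((1 : Matrix (Fin n) (Fin n) ℝ).submatrix id J).conjTranspose *
      ((1 : Matrix (Fin n) (Fin n) ℝ).submatrix id J) = 1 := by
    rw [Matrix.conjTranspose_submatrix, Matrix.conjTranspose_one,
      ← Matrix.submatrix_mul _ _ J id J Function.bijective_id, Matrix.one_mul,
      Matrix.submatrix_one J hJ]
  rw [h2] at h
  have h3 : ‖(1 : Matrix (Fin k) (Fin k) ℝ)‖ ≤ 1 := by
    rcases subsingleton_or_nontrivial (Matrix (Fin k) (Fin k) ℝ) with hs | hs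
    · rw [Subsingleton.elim (1 : Matrix (Fin k) (Fin k) ℝ) 0, norm_zero]
      exact zero_le_one
    · exact CStarRing.norm_one.le
  nlinarith [norm_nonneg ((1 : Matrix (Fin n) (Fin n) ℝ).submatrix id J)]

open scoped Matrix.Norms.L2Operator in
theorem column_id_aux {m n k : ℕ} (A Atil : Matrix (Fin m) (Fin n) ℝ)
    (ε : ℝ) (hε : 0 ≤ ε) (hrank : Atil.rank = k)
    (hclose : ‖A - Atil‖ ≤ ε)
    (X : Matrix (Fin k) (Fin n) ℝ) (J : Fin k → Fin n)
    (hID : Atil = Atil.submatrix id J * X) :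
    ‖A - A.submatrix id J * X‖ ≤ (1 + ‖X‖) * ε := by
  have hP := sel_norm_le J (sel_injective Atil hrank X J hID)
  set P := (1 : Matrix (Fin n) (Fin n) ℝ).submatrix id J with hPdef
  have hsub : ∀ B : Matrix (Fin m) (Fin n) ℝ, B.submatrix id J = B * P := by
    intro B
    ext i j
    simp [hPdef, Matrix.mul_apply, Matrix.one_apply]
  rw [hsub] at hID ⊢
  have key : A - A * P * X = (A - Atil) - (A - Atil) * P * X := by
    rw [Matrix.sub_mul, Matrix.sub_mul, ← hID]
    abel
  rw [key]
  have a1 := norm_sub_le (A - Atil) ((A - Atil) * P * X)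
  have a2 := Matrix.l2_opNorm_mul ((A - Atil) * P) X
  have a3 := Matrix.l2_opNorm_mul (A - Atil) P
  have a4 : ‖A - Atil‖ * ‖P‖ ≤ ε * 1 := mul_le_mul hclose hP (norm_nonneg _) hε
  have a5 : ‖(A - Atil) * P‖ * ‖X‖ ≤ ε * ‖X‖ :=
    mul_le_mul_of_nonneg_right (by linarith) (norm_nonneg _)
  linarith

/-- If `Ã` has rank `k`, `‖A - Ã‖₂ ≤ ε`, and `Ã = Ã[:,J] X`, then the column ID
`Â = A[:,J] X` satisfies `‖A - Â‖₂ ≤ (1 + ‖X‖₂) ε`. -/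
theorem column_id_error_bound {m n k : ℕ} (A Atil : Matrix (Fin m) (Fin n) ℝ)
    (ε : ℝ) (hε : 0 ≤ ε) (hrank : Atil.rank = k)
    (hclose : specNorm (A - Atil) ≤ ε)
    (X : Matrix (Fin k) (Fin n) ℝ) (J : Fin k → Fin n)
    (hID : Atil = Atil.submatrix id J * X) :
    specNorm (A - A.submatrix id J * X) ≤ (1 + specNorm X) * ε := by
  exact column_id_aux A Atil ε hε hrank hclose X J hID
end

section
/- Let A-tilde be an m x n real matrix of rank k, let X be a k x n real matrix and J an index vector of length k selecting columns, and suppose A-tilde = A-tilde[:, J] X. If |X_{ij}| <= M for all entries (i, j) of X, then ||X||_2 <= sqrt(1 + M^2 k (n - k)). -/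
/-- If `Ã` has rank `k`, `Ã = Ã[:,J] X`, and the entries of `X` are bounded by `M`,
then `‖X‖₂ ≤ sqrt(1 + M² k (n - k))`. -/
theorem interp_matrix_spectral_bound {m n k : ℕ} (Atil : Matrix (Fin m) (Fin n) ℝ)
    (hrank : Atil.rank = k)
    (X : Matrix (Fin k) (Fin n) ℝ) (J : Fin k → Fin n)
    (hID : Atil = Atil.submatrix id J * X)
    (M : ℝ) (hM : ∀ i j, |X i j| ≤ M) :
    specNorm X ≤ Real.sqrt (1 + M ^ 2 * (k : ℝ) * ((n : ℝ) - (k : ℝ))) := by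
  classical
  set C := Atil.submatrix id J with hC
  have hCr : k ≤ C.rank := by
    have h := Matrix.rank_mul_le_left C X
    rw [← hID, hrank] at h
    exact h
  have hinj : Function.Injective C.mulVec := by
    have hker : Module.finrank ℝ (LinearMap.ker C.mulVecLin) = 0 := by
      have h := LinearMap.finrank_range_add_finrank_ker C.mulVecLin
      have h2 : C.rank = Module.finrank ℝ (LinearMap.range C.mulVecLin) := rfl
      simp only [Module.finrank_fintype_fun_eq_card, Fintype.card_fin] at h
      omega
    have h3 := LinearMap.ker_eq_bot.mp (Submodule.finrank_eq_zero.mp hker)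
    exact h3
  have hcol : ∀ i i' : Fin k, X i' (J i) = if i' = i then 1 else 0 := by
    intro i i'
    have h : C.mulVec (fun l => X l (J i)) = C.mulVec (Pi.single i 1) := by
      rw [Matrix.mulVec_single_one]
      ext r
      have h4 := congrFun (congrFun hID r) (J i)
      simp only [Matrix.mul_apply] at h4
      simp only [Matrix.mulVec, dotProduct, Matrix.col_apply]
      rw [← h4]
      rfl
    have h5 := congrFun (hinj h) i'
    simpa [Pi.single_apply] using h5
  have hJ : Function.Injective J := by
    intro a b hab
    by_contra hne
    have h1 := hcol a a
    have h2 := hcol b a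
    rw [hab] at h1
    rw [h1] at h2
    simp [hne] at h2
  set S : Finset (Fin n) := (Finset.univ.image J)ᶜ with hS
  have hkn : k ≤ n := by simpa using Fintype.card_le_of_injective J hJ
  have hcard : (S.card : ℝ) = (n : ℝ) - k := by
    rw [hS, Finset.card_compl, Finset.card_image_of_injective _ hJ]
    simp [Nat.cast_sub hkn]
  have hsplit : ∀ f : Fin n → ℝ, ∑ j, f j = ∑ i, f (J i) + ∑ j ∈ S, f j := by
    intro f
    rw [← Finset.sum_add_sum_compl (Finset.univ.image J) f, Finset.sum_image hJ.injOn]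
  have hnk : (0 : ℝ) ≤ (n : ℝ) - k := by rw [← hcard]; exact Nat.cast_nonneg _
  have hc0 : 0 ≤ M ^ 2 * (k : ℝ) * ((n : ℝ) - (k : ℝ)) := by positivity
  unfold specNorm
  refine ContinuousLinearMap.opNorm_le_bound _ (Real.sqrt_nonneg _) fun v => ?_
  set x : EuclideanSpace ℝ (Fin k) := WithLp.toLp 2 fun i => v (J i) with hx
  set r : EuclideanSpace ℝ (Fin k) := WithLp.toLp 2 fun i => ∑ j ∈ S, X i j * v j with hr
  have hsum : LinearMap.toContinuousLinearMap (Matrix.toEuclideanLin X) v = x + r := by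
    ext i
    have h : (LinearMap.toContinuousLinearMap (Matrix.toEuclideanLin X) v) i
        = ∑ j, X i j * v j := rfl
    rw [h, hsplit]
    simp [hcol, hx, hr]
  have hv : ‖v‖ ^ 2 = ‖x‖ ^ 2 + ∑ j ∈ S, v j ^ 2 := by
    rw [EuclideanSpace.real_norm_sq_eq, EuclideanSpace.real_norm_sq_eq, hsplit]
  have hb0 : 0 ≤ ∑ j ∈ S, v j ^ 2 := Finset.sum_nonneg fun _ _ => sq_nonneg _
  have hrb : ‖r‖ ^ 2 ≤ M ^ 2 * (k : ℝ) * ((n : ℝ) - k) * ∑ j ∈ S, v j ^ 2 := by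
    rw [EuclideanSpace.real_norm_sq_eq]
    have h : ∀ i ∈ (Finset.univ : Finset (Fin k)),
        r i ^ 2 ≤ (((n : ℝ) - k) * M ^ 2) * ∑ j ∈ S, v j ^ 2 := by
      intro i _
      have h1 : r i ^ 2 ≤ (∑ j ∈ S, X i j ^ 2) * ∑ j ∈ S, v j ^ 2 :=
        Finset.sum_mul_sq_le_sq_mul_sq S (fun j => X i j) (fun j => v j)
      refine h1.trans (mul_le_mul_of_nonneg_right ?_ hb0)
      rw [← hcard, ← nsmul_eq_mul]
      exact Finset.sum_le_card_nsmul _ _ _ fun j _ => sq_le_sq' (abs_le.mp (hM i j)).1 (abs_le.mp (hM i j)).2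
    refine (Finset.sum_le_card_nsmul _ _ _ h).trans (le_of_eq ?_)
    simp
    ring
  rw [hsum]
  generalize M ^ 2 * (k : ℝ) * ((n : ℝ) - k) = c at *
  generalize (∑ j ∈ S, v j ^ 2) = b at *
  refine (norm_add_le x r).trans ?_
  rw [← Real.sqrt_sq (norm_nonneg v), ← Real.sqrt_mul (by positivity), hv]
  apply Real.le_sqrt_of_sq_le
  have h1 : ‖r‖ ≤ Real.sqrt c * Real.sqrt b := by
    rw [← Real.sqrt_mul hc0]
    exact Real.le_sqrt_of_sq_le hrb
  have h2 : (‖x‖ + ‖r‖) ^ 2 ≤ (‖x‖ + Real.sqrt c * Real.sqrt b) ^ 2 := by gcongr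
  nlinarith [sq_nonneg (Real.sqrt c * ‖x‖ - Real.sqrt b), Real.sq_sqrt hc0, Real.sq_sqrt hb0,
    show (Real.sqrt c * Real.sqrt b) ^ 2 = c * b by
      rw [mul_pow, Real.sq_sqrt hc0, Real.sq_sqrt hb0],
    show (Real.sqrt c * ‖x‖) ^ 2 = c * ‖x‖ ^ 2 by rw [mul_pow, Real.sq_sqrt hc0]]
end

section
/- Let G be an r x c real matrix with a column-pivoted decomposition G P = F T, where P is a c x c permutation matrix, F is r x w with w = min{r, c}, and T is a w x c upper-triangular matrix; let k be a positive integer with k < rank(G). Partition F = [F_1 F_2] and T = [T_1; T_2] so that F_1 has k columns and T_1 has k rows. For an invertible upper-triangular w x w matrix U, define g_k(U) = F (U^{-1})[:, 1:k] U[1:k, :] T P^T. Then: (i) ||G - g_k(I_w)||_F = ||F_2 T_2||_F; (ii) the infimum of ||G - g_k(U)||_F over all invertible upper-triangular w x w matrices U equals ||(I - F_1 F_1^dagger) F_2 T_2||_F, and it is attained at the block matrix U_star = [[I_k, F_1^dagger F_2], [0, I_{w-k}]]; (iii) if range(F_1) and range(F_2) are orthogonal subspaces of R^r, then the identity matrix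 attains the infimum. -/
open Matrix

/-- The Frobenius norm of a real matrix. -/
noncomputable def frobNorm {m n : Type*} [Fintype m] [Fintype n] (A : Matrix m n ℝ) : ℝ :=
  Real.sqrt (∑ i, ∑ j, A i j ^ 2)

/-- `B` is the Moore–Penrose pseudoinverse of `A`. -/
def IsMoorePenrose {m n : Type*} [Fintype m] [Fintype n] (A : Matrix m n ℝ)
    (B : Matrix n m ℝ) : Prop :=
  A * B * A = A ∧ B * A * B = B ∧ (A * B)ᵀ = A * B ∧ (B * A)ᵀ = B * A

/-- The inclusion `Fin (w - k) → Fin w` of the trailing `w - k` indices. -/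
def tailIdx {w k : ℕ} (hkw : k ≤ w) (i : Fin (w - k)) : Fin w :=
  Fin.cast (Nat.add_sub_cancel' hkw) (Fin.natAdd k i)

/-- `g_k(U) = F (U⁻¹)[:, 1:k] U[1:k, :] T Pᵀ`. -/
noncomputable def gk {r w c k : ℕ} (hkw : k ≤ w) (F : Matrix (Fin r) (Fin w) ℝ)
    (T : Matrix (Fin w) (Fin c) ℝ) (P : Matrix (Fin c) (Fin c) ℝ)
    (U : Matrix (Fin w) (Fin w) ℝ) : Matrix (Fin r) (Fin c) ℝ :=
  F * (U⁻¹).submatrix id (Fin.castLE hkw) * U.submatrix (Fin.castLE hkw) id * T * Pᵀ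

/-- The unitriangular block matrix `[[I_k, B], [0, I_{w-k}]]`. -/
noncomputable def cornerUnitriangular {w k : ℕ} (hkw : k ≤ w)
    (B : Matrix (Fin k) (Fin (w - k)) ℝ) : Matrix (Fin w) (Fin w) ℝ :=
  Matrix.of fun i j =>
    if h : (i : ℕ) < k ∧ k ≤ (j : ℕ) then
      B ⟨(i : ℕ), h.1⟩ ⟨(j : ℕ) - k, by have hj := j.isLt; have h2 := h.2; omega⟩
    else if i = j then (1 : ℝ) else 0

lemma split_mul {w k : ℕ} (hkw : k ≤ w) {m n : Type*} (A : Matrix m (Fin w) ℝ)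
    (B : Matrix (Fin w) n ℝ) :
    A * B = A.submatrix id (Fin.castLE hkw) * B.submatrix (Fin.castLE hkw) id +
      A.submatrix id (tailIdx hkw) * B.submatrix (tailIdx hkw) id := by
  ext i j
  simp only [Matrix.mul_apply, Matrix.add_apply, Matrix.submatrix_apply, id]
  let e : Fin k ⊕ Fin (w - k) ≃ Fin w :=
    finSumFinEquiv.trans (finCongr (Nat.add_sub_cancel' hkw))
  rw [← e.sum_comp, Fintype.sum_sum_type]
  rfl

lemma frobNorm_sq {m n : Type*} [Fintype m] [Fintype n] (A : Matrix m n ℝ) :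
    (∑ i, ∑ j, A i j ^ 2) = (Aᵀ * A).trace := by
  simp only [Matrix.trace, Matrix.diag, Matrix.mul_apply, Matrix.transpose_apply]
  rw [Finset.sum_comm]
  simp only [sq]

lemma frobNorm_proj_le {m n : Type*} [Fintype m] [Fintype n] [DecidableEq m]
    (Q : Matrix m m ℝ) (hQ : Qᵀ = Q) (hQQ : Q * Q = Q) (A : Matrix m n ℝ) :
    frobNorm (Q * A) ≤ frobNorm A := by
  unfold frobNorm
  apply Real.sqrt_le_sqrt
  have h1 : 0 ≤ ∑ i, ∑ j, ((1 - Q) * A : Matrix m n ℝ) i j ^ 2 :=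
    Finset.sum_nonneg fun i _ => Finset.sum_nonneg fun j _ => sq_nonneg _
  have h2 : (Aᵀ * A) = (Q * A)ᵀ * (Q * A) + ((1 - Q) * A)ᵀ * ((1 - Q) * A) := by
    have e1 : (Q * A)ᵀ * (Q * A) = Aᵀ * (Q * Q) * A := by
      rw [Matrix.transpose_mul, hQ]; simp only [Matrix.mul_assoc]
    have e2 : ((1 - Q) * A)ᵀ * ((1 - Q) * A) = Aᵀ * ((1 - Q) * (1 - Q)) * A := by
      rw [Matrix.transpose_mul, Matrix.transpose_sub, hQ, Matrix.transpose_one]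
      simp only [Matrix.mul_assoc]
    have e3 : (1 - Q) * (1 - Q) = 1 - Q := by
      rw [Matrix.mul_sub, Matrix.sub_mul, Matrix.sub_mul, hQQ]; simp
    rw [e1, e2, e3, hQQ, Matrix.mul_sub, Matrix.sub_mul]; simp
  rw [frobNorm_sq] at h1 ⊢
  rw [frobNorm_sq, h2, Matrix.trace_add]
  linarith

lemma frobNorm_mul_perm {m : Type*} [Fintype m] {c : ℕ} (E : Matrix m (Fin c) ℝ)
    (P : Matrix (Fin c) (Fin c) ℝ) (σ : Equiv.Perm (Fin c))
    (hP : ∀ i j, P i j = if σ j = i then (1 : ℝ) else 0) :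
    frobNorm (E * P) = frobNorm E := by
  unfold frobNorm
  congr 1
  refine Finset.sum_congr rfl fun i _ => ?_
  rw [← Equiv.sum_comp σ (fun j => E i j ^ 2)]
  refine Finset.sum_congr rfl fun j _ => ?_
  simp [Matrix.mul_apply, hP]

lemma perm_orth {c : ℕ} (P : Matrix (Fin c) (Fin c) ℝ) (σ : Equiv.Perm (Fin c))
    (hP : ∀ i j, P i j = if σ j = i then (1 : ℝ) else 0) : Pᵀ * P = 1 := by
  ext i j
  simp [Matrix.mul_apply, hP, Matrix.one_apply, eq_comm]

lemma err_eq {r c w k : ℕ} (hkw : k ≤ w)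
    (G : Matrix (Fin r) (Fin c) ℝ)
    (P : Matrix (Fin c) (Fin c) ℝ)
    (hP : ∃ σ : Equiv.Perm (Fin c), ∀ i j, P i j = if σ j = i then (1 : ℝ) else 0)
    (F : Matrix (Fin r) (Fin w) ℝ) (T : Matrix (Fin w) (Fin c) ℝ)
    (hGP : G * P = F * T) (U : Matrix (Fin w) (Fin w) ℝ) (hU : IsUnit U)
    (hUt : ∀ (i j : Fin w), (j : ℕ) < (i : ℕ) → U i j = 0) :
    ∃ V : Matrix (Fin k) (Fin k) ℝ,
      V * U.submatrix (Fin.castLE hkw) (Fin.castLE hkw) = 1 ∧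
      frobNorm (G - gk hkw F T P U) =
        frobNorm (F.submatrix id (tailIdx hkw) * T.submatrix (tailIdx hkw) id -
          F.submatrix id (Fin.castLE hkw) *
            (V * U.submatrix (Fin.castLE hkw) (tailIdx hkw) * T.submatrix (tailIdx hkw) id)) := by
  obtain ⟨σ, hσ⟩ := hP
  have hdet : IsUnit U.det := (Matrix.isUnit_iff_isUnit_det U).1 hU
  have hVt : Matrix.BlockTriangular U⁻¹ id := by
    haveI : Invertible U := hU.invertible
    apply Matrix.blockTriangular_inv_of_blockTriangular
    intro i j hij
    exact hUt i j hij
  have hz : ∀ A : Matrix (Fin w) (Fin w) ℝ, (∀ (i j : Fin w), (j : ℕ) < (i : ℕ) → A i j = 0) →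
      A.submatrix (tailIdx hkw) (Fin.castLE hkw) = 0 := by
    intro A hA
    ext i j
    apply hA
    simp [tailIdx]
    omega
  have hV0 := hz U⁻¹ (fun i j hij => hVt hij)
  have hU0 := hz U hUt
  have hVU : U⁻¹.submatrix (Fin.castLE hkw) (Fin.castLE hkw) *
      U.submatrix (Fin.castLE hkw) (Fin.castLE hkw) = 1 := by
    have h := congrArg (fun M => M.submatrix (Fin.castLE hkw) (Fin.castLE hkw))
      (split_mul hkw U⁻¹ U)
    simp only [Matrix.nonsing_inv_mul U hdet] at h
    have h1 : (1 : Matrix (Fin w) (Fin w) ℝ).submatrix (Fin.castLE hkw) (Fin.castLE hkw) = 1 :=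
      Matrix.submatrix_one _ (Fin.castLE_injective hkw)
    rw [h1] at h
    rw [h, Matrix.submatrix_add]
    have h2 : (U⁻¹.submatrix id (tailIdx hkw) * U.submatrix (tailIdx hkw) id).submatrix
        (Fin.castLE hkw) (Fin.castLE hkw) =
        U⁻¹.submatrix (Fin.castLE hkw) (tailIdx hkw) *
          U.submatrix (tailIdx hkw) (Fin.castLE hkw) := rfl
    simp only [Pi.add_apply, h2, hU0, Matrix.mul_zero, add_zero]
    rfl
  refine ⟨U⁻¹.submatrix (Fin.castLE hkw) (Fin.castLE hkw), hVU, ?_⟩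
  · rw [← frobNorm_mul_perm _ P σ hσ]
    congr 1
    have hF := split_mul hkw F (U⁻¹.submatrix id (Fin.castLE hkw))
    simp only [Matrix.submatrix_submatrix, Function.comp_id, Function.id_comp, hV0,
      Matrix.mul_zero, add_zero] at hF
    have hUT := split_mul hkw (U.submatrix (Fin.castLE hkw) id) T
    simp only [Matrix.submatrix_submatrix, Function.comp_id, Function.id_comp] at hUT
    rw [Matrix.sub_mul, hGP, gk, Matrix.mul_assoc _ Pᵀ P, perm_orth P σ hσ, Matrix.mul_one,
      hF, Matrix.mul_assoc _ _ T, hUT, split_mul hkw F T]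
    rw [Matrix.mul_add, Matrix.mul_assoc _ _ (_ * _), ← Matrix.mul_assoc _ _ (T.submatrix (Fin.castLE hkw) id), hVU, Matrix.one_mul]
    simp only [Matrix.mul_assoc]
    abel

lemma corner_tri {w k : ℕ} (hkw : k ≤ w) (B : Matrix (Fin k) (Fin (w - k)) ℝ) 
    (i j : Fin w) (hij : (j : ℕ) < (i : ℕ)) : cornerUnitriangular hkw B i j = 0 := by
  have h1 : ¬ ((i : ℕ) < k ∧ k ≤ (j : ℕ)) := by omega
  have h2 : i ≠ j := by rintro rfl; omega
  simp [cornerUnitriangular, h1, h2]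

lemma corner_unit {w k : ℕ} (hkw : k ≤ w) (B : Matrix (Fin k) (Fin (w - k)) ℝ) :
    IsUnit (cornerUnitriangular hkw B) := by
  rw [Matrix.isUnit_iff_isUnit_det, Matrix.det_of_upperTriangular (fun i j h => corner_tri hkw B i j h)]
  have : ∀ i, cornerUnitriangular hkw B i i = 1 := by
    intro i
    have h1 : ¬ ((i : ℕ) < k ∧ k ≤ (i : ℕ)) := by omega
    simp [cornerUnitriangular, h1]
  simp [this]

lemma corner_11 {w k : ℕ} (hkw : k ≤ w) (B : Matrix (Fin k) (Fin (w - k)) ℝ) :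
    (cornerUnitriangular hkw B).submatrix (Fin.castLE hkw) (Fin.castLE hkw) = 1 := by
  ext i j
  have h1 : ¬ ((i : ℕ) < k ∧ k ≤ (j : ℕ)) := by omega
  simp [cornerUnitriangular, Matrix.one_apply, Fin.ext_iff]

lemma corner_12 {w k : ℕ} (hkw : k ≤ w) (B : Matrix (Fin k) (Fin (w - k)) ℝ) :
    (cornerUnitriangular hkw B).submatrix (Fin.castLE hkw) (tailIdx hkw) = B := by
  ext i j
  simp [cornerUnitriangular, tailIdx]

/-- Truncation of column-pivoted decompositions after a change of basis:
(i) `‖G - g_k(I)‖_F = ‖F₂T₂‖_F`;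
(ii) the infimum of `‖G - g_k(U)‖_F` over invertible upper-triangular `U` equals
`‖(I - F₁F₁†)F₂T₂‖_F`, attained at `U⋆ = [[I, F₁†F₂],[0, I]]`;
(iii) if `range F₁ ⟂ range F₂`, then the identity attains the infimum. -/
theorem truncated_column_pivoted_decomposition
    {r c w k : ℕ} (hw : w = min r c) (hkpos : 0 < k) (hkw : k ≤ w)
    (G : Matrix (Fin r) (Fin c) ℝ) (hkrank : k < G.rank)
    (P : Matrix (Fin c) (Fin c) ℝ)
    (hP : ∃ σ : Equiv.Perm (Fin c), ∀ i j, P i j = if σ j = i then (1 : ℝ) else 0)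
    (F : Matrix (Fin r) (Fin w) ℝ) (T : Matrix (Fin w) (Fin c) ℝ)
    (hT : ∀ (i : Fin w) (j : Fin c), (j : ℕ) < (i : ℕ) → T i j = 0)
    (hGP : G * P = F * T)
    (F1dag : Matrix (Fin k) (Fin r) ℝ)
    (hdag : IsMoorePenrose (F.submatrix id (Fin.castLE hkw)) F1dag) :
    frobNorm (G - gk hkw F T P 1) =
      frobNorm (F.submatrix id (tailIdx hkw) * T.submatrix (tailIdx hkw) id) ∧
    sInf {x : ℝ | ∃ U : Matrix (Fin w) (Fin w) ℝ, IsUnit U ∧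
        (∀ (i j : Fin w), (j : ℕ) < (i : ℕ) → U i j = 0) ∧ x = frobNorm (G - gk hkw F T P U)} =
      frobNorm ((1 - F.submatrix id (Fin.castLE hkw) * F1dag) *
        (F.submatrix id (tailIdx hkw) * T.submatrix (tailIdx hkw) id)) ∧
    (IsUnit (cornerUnitriangular hkw (F1dag * F.submatrix id (tailIdx hkw))) ∧
      (∀ (i j : Fin w), (j : ℕ) < (i : ℕ) →
        cornerUnitriangular hkw (F1dag * F.submatrix id (tailIdx hkw)) i j = 0) ∧
      frobNorm (G - gk hkw F T P
          (cornerUnitriangular hkw (F1dag * F.submatrix id (tailIdx hkw)))) =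
        frobNorm ((1 - F.submatrix id (Fin.castLE hkw) * F1dag) *
          (F.submatrix id (tailIdx hkw) * T.submatrix (tailIdx hkw) id))) ∧
    ((∀ (u : Fin k → ℝ) (v : Fin (w - k) → ℝ),
        (∑ a, (F.submatrix id (Fin.castLE hkw)).mulVec u a *
          (F.submatrix id (tailIdx hkw)).mulVec v a) = 0) →
      frobNorm (G - gk hkw F T P 1) =
        sInf {x : ℝ | ∃ U : Matrix (Fin w) (Fin w) ℝ, IsUnit U ∧
          (∀ (i j : Fin w), (j : ℕ) < (i : ℕ) → U i j = 0) ∧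
          x = frobNorm (G - gk hkw F T P U)}) := by
  have key := err_eq hkw G P hP F T hGP
  have hct := corner_tri hkw (F1dag * F.submatrix id (tailIdx hkw))
  have hcu := corner_unit hkw (F1dag * F.submatrix id (tailIdx hkw))
  have hc11 := corner_11 hkw (F1dag * F.submatrix id (tailIdx hkw))
  have hc12 := corner_12 hkw (F1dag * F.submatrix id (tailIdx hkw))
  have h1t : ∀ (i j : Fin w), (j : ℕ) < (i : ℕ) → (1 : Matrix (Fin w) (Fin w) ℝ) i j = 0 := by
    intro i j hij
    exact Matrix.one_apply_ne (by rintro rfl; omega)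
  obtain ⟨hd1, hd2, hd3, hd4⟩ := hdag
  have hone : frobNorm (G - gk hkw F T P 1) =
      frobNorm (F.submatrix id (tailIdx hkw) * T.submatrix (tailIdx hkw) id) := by
    obtain ⟨V, -, h⟩ := key 1 isUnit_one h1t
    have h12 : (1 : Matrix (Fin w) (Fin w) ℝ).submatrix (Fin.castLE hkw) (tailIdx hkw) = 0 := by
      ext i j
      apply Matrix.one_apply_ne
      intro h
      have h' := congrArg Fin.val h
      simp [tailIdx] at h'
      omega
    rw [h, h12]
    simp
  generalize cornerUnitriangular hkw (F1dag * F.submatrix id (tailIdx hkw)) = C at *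
  generalize F.submatrix id (tailIdx hkw) = F2 at *
  generalize T.submatrix (tailIdx hkw) id = T2 at *
  generalize F.submatrix id (Fin.castLE hkw) = F1 at *
  have hC : frobNorm (G - gk hkw F T P C) = frobNorm ((1 - F1 * F1dag) * (F2 * T2)) := by
    obtain ⟨V, hV, h⟩ := key C hcu hct
    rw [hc11, Matrix.mul_one] at hV
    rw [h, hV, hc12, Matrix.sub_mul, Matrix.one_mul, Matrix.one_mul]
    simp only [Matrix.mul_assoc]
  have hinf : sInf {x : ℝ | ∃ U : Matrix (Fin w) (Fin w) ℝ, IsUnit U ∧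
        (∀ (i j : Fin w), (j : ℕ) < (i : ℕ) → U i j = 0) ∧ x = frobNorm (G - gk hkw F T P U)} =
      frobNorm ((1 - F1 * F1dag) * (F2 * T2)) := by
    apply IsLeast.csInf_eq
    refine ⟨⟨C, hcu, hct, hC.symm⟩, ?_⟩
    rintro x ⟨U, hU, hUt, rfl⟩
    obtain ⟨V, -, h⟩ := key U hU hUt
    rw [h]
    have hQ : (1 - F1 * F1dag)ᵀ = 1 - F1 * F1dag := by
      rw [Matrix.transpose_sub, hd3, Matrix.transpose_one]
    have hQQ : (1 - F1 * F1dag) * (1 - F1 * F1dag) = 1 - F1 * F1dag := by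
      have : F1 * F1dag * (F1 * F1dag) = F1 * F1dag := by rw [← Matrix.mul_assoc, hd1]
      rw [Matrix.mul_sub, Matrix.sub_mul, Matrix.sub_mul, this]; simp
    have hQF : (1 - F1 * F1dag) * F1 = 0 := by
      rw [Matrix.sub_mul, hd1, Matrix.one_mul, sub_self]
    refine le_trans (le_of_eq ?_) (frobNorm_proj_le _ hQ hQQ _)
    rw [Matrix.mul_sub, ← Matrix.mul_assoc _ F1, hQF, Matrix.zero_mul, sub_zero]
  refine ⟨hone, hinf, ⟨hcu, hct, hC⟩, ?_⟩
  intro horth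
  rw [hone, hinf]
  have h0 : F1ᵀ * F2 = 0 := by
    ext i j
    have := horth (Pi.single i 1) (Pi.single j 1)
    simpa [Matrix.mul_apply] using this
  have h00 : F1 * F1dag * F2 = 0 := by
    rw [← hd3, Matrix.transpose_mul, Matrix.mul_assoc, h0, Matrix.mul_zero]
  rw [Matrix.sub_mul, ← Matrix.mul_assoc (F1 * F1dag) F2, h00, Matrix.zero_mul, sub_zero, Matrix.one_mul]
end

section
/- Let A be an m x n real matrix, S a d x m real matrix, and A_sk = S A. Let k = rank(A) and let U be an m x k matrix whose columns form an orthonormal basis for range(A). Suppose rank(A_sk) = rank(A), and suppose M is an n x k matrix such that the columns of A_sk M form an orthonormal basis for range(A_sk). Then the multiset of singular values of the m x k matrix A M equals the multiset of reciprocals of the singular values of the d x k matrix S U. -/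
open Matrix

/-- The Gram matrix `AᵀA` of a real matrix is Hermitian (symmetric). -/
theorem gram_isHermitian {ι κ : Type*} [Fintype ι] (A : Matrix ι κ ℝ) :
    (Aᵀ * A).IsHermitian := by
  show (Aᵀ * A)ᴴ = Aᵀ * A
  ext i j
  simp [Matrix.conjTranspose_apply, Matrix.transpose_apply, Matrix.mul_apply, mul_comm]

/-- The multiset of singular values of a real matrix: the square roots of the
eigenvalues of `AᵀA`, counted with multiplicity. -/
noncomputable def svMultiset {ι : Type*} [Fintype ι] {n : ℕ} (A : Matrix ι (Fin n) ℝ) :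
    Multiset ℝ :=
  Multiset.map (fun i => Real.sqrt ((gram_isHermitian A).eigenvalues i)) Finset.univ.val

theorem charpoly_roots_inverse {k : ℕ} (G H : Matrix (Fin k) (Fin k) ℝ) (hG : G.IsHermitian)
    (hGH : G * H = 1) :
    H.charpoly.roots = Multiset.map (fun i => (hG.eigenvalues i)⁻¹) Finset.univ.val := by
  have hdet : G.det ≠ 0 := by
    intro h
    have := congrArg Matrix.det hGH
    rw [Matrix.det_mul, h] at this
    simp at this
  have hne : ∀ i, hG.eigenvalues i ≠ 0 := by
    intro i hi
    apply hdet
    rw [hG.det_eq_prod_eigenvalues]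
    exact Finset.prod_eq_zero (Finset.mem_univ i) (by simp [hi])
  have hs := hG.spectral_theorem
  rw [Unitary.conjStarAlgAut_apply] at hs
  set V : Matrix (Fin k) (Fin k) ℝ := (hG.eigenvectorUnitary : Matrix (Fin k) (Fin k) ℝ) with hV
  have hVV : star V * V = 1 := Unitary.coe_star_mul_self _
  have hVV2 : V * star V = 1 := Unitary.coe_mul_star_self _
  have hDD : diagonal (RCLike.ofReal ∘ hG.eigenvalues : Fin k → ℝ) *
      diagonal (fun i => (hG.eigenvalues i)⁻¹) = 1 := by
    rw [diagonal_mul_diagonal, ← diagonal_one]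
    congr 1
    ext i
    simp [hne i]
  set D : Matrix (Fin k) (Fin k) ℝ := diagonal (RCLike.ofReal ∘ hG.eigenvalues : Fin k → ℝ)
  set Einv : Matrix (Fin k) (Fin k) ℝ := diagonal (fun i => (hG.eigenvalues i)⁻¹) with hEinv
  have h1 : G * (V * Einv * star V) = 1 := by
    calc G * (V * Einv * star V) = (V * D * star V) * (V * Einv * star V) := by
          exact congrArg (· * (V * Einv * star V)) hs
      _ = V * D * (star V * V) * Einv * star V := by simp only [Matrix.mul_assoc]
      _ = V * (D * Einv) * star V := by rw [hVV, Matrix.mul_one]; simp only [Matrix.mul_assoc]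
      _ = 1 := by rw [hDD, Matrix.mul_one, hVV2]
  have hH : H = V * Einv * star V := by
    have h2 : H * G = 1 := mul_eq_one_comm.mp hGH
    calc H = H * (G * (V * Einv * star V)) := by rw [h1, Matrix.mul_one]
      _ = V * Einv * star V := by rw [← Matrix.mul_assoc, h2, Matrix.one_mul]
  rw [hH, charpoly_mul_comm, ← Matrix.mul_assoc, hVV, Matrix.one_mul, hEinv, charpoly_diagonal,
    Polynomial.roots_prod]
  · simp
  · simp [Finset.prod_ne_zero_iff, Polynomial.X_sub_C_ne_zero]

/-- If `rank(SA) = rank(A) = k`, `U` is an orthonormal basis of `range(A)`, and the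
columns of `(SA)M` form an orthonormal basis of `range(SA)`, then the singular values
of `AM` are the reciprocals of the singular values of `SU`. -/
theorem preconditioner_singular_values {m n d : ℕ}
    (A : Matrix (Fin m) (Fin n) ℝ) (S : Matrix (Fin d) (Fin m) ℝ)
    (U : Matrix (Fin m) (Fin A.rank) ℝ)
    (hUorth : Uᵀ * U = 1)
    (hUrange : LinearMap.range U.mulVecLin = LinearMap.range A.mulVecLin)
    (hrank : (S * A).rank = A.rank)
    (M : Matrix (Fin n) (Fin A.rank) ℝ)
    (hMorth : (S * A * M)ᵀ * (S * A * M) = 1)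
    (hMrange : LinearMap.range (S * A * M).mulVecLin = LinearMap.range (S * A).mulVecLin) :
    svMultiset (A * M) = (svMultiset (S * U)).map (fun s => s⁻¹) := by
  have hC : ∃ C : Matrix (Fin A.rank) (Fin A.rank) ℝ, A * M = U * C := by
    have h : ∀ j, ∃ c, U *ᵥ c = (A * M).col j := by
      intro j
      have : A *ᵥ (M.col j) ∈ LinearMap.range U.mulVecLin := by
        rw [hUrange]; exact ⟨M.col j, rfl⟩
      obtain ⟨c, hc⟩ := this
      refine ⟨c, ?_⟩
      rw [Matrix.mulVecLin_apply] at hc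
      rw [hc]
      ext i
      simp [Matrix.mul_apply, Matrix.mulVec, dotProduct]
    choose c hc using h
    refine ⟨Matrix.of fun i j => c j i, ?_⟩
    ext i j
    have := congrFun (hc j) i
    simp only [Matrix.col_apply] at this
    rw [← this]
    simp [Matrix.mul_apply, Matrix.mulVec, dotProduct]
  obtain ⟨C, hC⟩ := hC
  have hGram : (A * M)ᵀ * (A * M) = Cᵀ * C := by
    rw [hC, transpose_mul, Matrix.mul_assoc, ← Matrix.mul_assoc Uᵀ, hUorth, Matrix.one_mul]
  have hG : ((S * U)ᵀ * (S * U)) * (C * Cᵀ) = 1 := by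
    rw [← Matrix.mul_assoc]
    apply mul_eq_one_comm.mp
    rw [Matrix.mul_assoc S A M, hC, ← Matrix.mul_assoc S U C, transpose_mul] at hMorth
    simpa only [Matrix.mul_assoc] using hMorth
  have hroots := charpoly_roots_inverse _ _ (gram_isHermitian (S * U)) hG
  rw [charpoly_mul_comm, ← hGram, (gram_isHermitian (A * M)).roots_charpoly_eq_eigenvalues]
    at hroots
  have := congrArg (Multiset.map Real.sqrt) hroots
  simpa [svMultiset, Multiset.map_map, Function.comp_def, Real.sqrt_inv] using this
end

section
/- Let A be an m x n real matrix and S a d x m real matrix with n <= d. Let J be a permutation of (1, ..., n), k a positive integer, Q_sk a d x k matrix with orthonormal columns, and R_sk a k x n upper-triangular matrix whose leading k x k block R_1 is invertible, such that S A[:, J] = Q_sk R_sk. Define A_pre = A[:, J(1:k)] R_1^{-1}, let Q be an m x k matrix with orthonormal columns and R_pre a k x k upper-triangular matrix with A_pre = Q R_pre, and set R = R_pre R_sk. If rank(S A) = rank(A), then A[:, J] = Q R. -/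
open Matrix

lemma mul_eq_zero_of_rank_eq {m n d p : ℕ} (A : Matrix (Fin m) (Fin n) ℝ)
    (S : Matrix (Fin d) (Fin m) ℝ) (hrank : (S * A).rank = A.rank)
    (Y : Matrix (Fin n) (Fin p) ℝ) (h : S * A * Y = 0) : A * Y = 0 := by
  have hle : LinearMap.ker A.mulVecLin ≤ LinearMap.ker (S * A).mulVecLin := by
    intro v hv
    simp only [LinearMap.mem_ker, mulVecLin_apply] at hv ⊢
    rw [← mulVec_mulVec, hv, mulVec_zero]
  have hker : LinearMap.ker A.mulVecLin = LinearMap.ker (S * A).mulVecLin := by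
    apply Submodule.eq_of_le_of_finrank_eq hle
    have h1 := LinearMap.finrank_range_add_finrank_ker A.mulVecLin
    have h2 := LinearMap.finrank_range_add_finrank_ker (S * A).mulVecLin
    unfold Matrix.rank at hrank
    omega
  ext i j
  have hv : (fun l => Y l j) ∈ LinearMap.ker (S * A).mulVecLin := by
    rw [LinearMap.mem_ker, mulVecLin_apply]
    ext i'
    exact congrFun (congrFun h i') j
  rw [← hker, LinearMap.mem_ker, mulVecLin_apply] at hv
  exact congrFun hv i

/-- Exactness of preconditioned Cholesky QRCP: if `rank(SA) = rank(A)`, then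
`A[:,J] = Q (R_pre R_sk)`. -/
theorem sap_chol_qrcp_exact {m n d k : ℕ} (hnd : n ≤ d) (hk : 0 < k) (hkn : k ≤ n)
    (A : Matrix (Fin m) (Fin n) ℝ) (S : Matrix (Fin d) (Fin m) ℝ)
    (σ : Equiv.Perm (Fin n))
    (Qsk : Matrix (Fin d) (Fin k) ℝ) (hQsk : Qskᵀ * Qsk = 1)
    (Rsk : Matrix (Fin k) (Fin n) ℝ)
    (hRskTri : ∀ (i : Fin k) (j : Fin n), (j : ℕ) < (i : ℕ) → Rsk i j = 0)
    (hR1 : IsUnit (Rsk.submatrix id (Fin.castLE hkn)))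
    (hdecomp : S * A.submatrix id (fun j => σ j) = Qsk * Rsk)
    (Q : Matrix (Fin m) (Fin k) ℝ) (hQ : Qᵀ * Q = 1)
    (Rpre : Matrix (Fin k) (Fin k) ℝ)
    (hRpreTri : ∀ (i j : Fin k), (j : ℕ) < (i : ℕ) → Rpre i j = 0)
    (hApre : A.submatrix id (fun i : Fin k => σ (Fin.castLE hkn i)) *
        (Rsk.submatrix id (Fin.castLE hkn))⁻¹ = Q * Rpre)
    (hrank : (S * A).rank = A.rank) :
    A.submatrix id (fun j => σ j) = Q * (Rpre * Rsk) := by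
  set R1 := Rsk.submatrix id (Fin.castLE hkn) with hR1def
  have hdet : IsUnit R1.det := (Matrix.isUnit_iff_isUnit_det _).1 hR1
  set Pm : Matrix (Fin n) (Fin n) ℝ := (1 : Matrix (Fin n) (Fin n) ℝ).submatrix id (fun j => σ j)
    with hPm
  set E : Matrix (Fin n) (Fin k) ℝ := (1 : Matrix (Fin n) (Fin n) ℝ).submatrix id (Fin.castLE hkn)
    with hE
  have hB : A.submatrix id (fun j => σ j) = A * Pm := by
    ext i j
    simp [hPm, Matrix.mul_apply, Matrix.one_apply]
  have hA1 : A.submatrix id (fun i : Fin k => σ (Fin.castLE hkn i)) = A * Pm * E := by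
    rw [← hB]
    ext i j
    simp [hE, Matrix.mul_apply, Matrix.one_apply]
  have hR : Rsk * E = R1 := by
    ext i j
    simp [hE, hR1def, Matrix.mul_apply, Matrix.one_apply]
  rw [hB] at hdecomp ⊢
  rw [hA1] at hApre
  rw [← Matrix.mul_assoc Q, ← hApre]
  have key : A * (Pm * (1 - E * R1⁻¹ * Rsk)) = 0 := by
    apply mul_eq_zero_of_rank_eq A S hrank
    calc S * A * (Pm * (1 - E * R1⁻¹ * Rsk))
        = S * (A * Pm) * (1 - E * R1⁻¹ * Rsk) := by simp only [Matrix.mul_assoc]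
      _ = Qsk * (Rsk - (Rsk * E) * R1⁻¹ * Rsk) := by
          rw [hdecomp]; simp only [Matrix.mul_assoc, Matrix.mul_sub, Matrix.mul_one]
      _ = 0 := by
          rw [hR, Matrix.mul_nonsing_inv _ hdet, Matrix.one_mul, sub_self, Matrix.mul_zero]
  simp only [Matrix.mul_assoc, Matrix.mul_sub, Matrix.mul_one] at key ⊢
  exact sub_eq_zero.1 key
end

section
/- Let A be an m x n real matrix and S a d x m real matrix with n <= d. Let J be a permutation of (1, ..., n), k a positive integer, Q_sk a d x k matrix with orthonormal columns, and R_sk a k x n upper-triangular matrix whose leading k x k block R_1 is invertible, such that S A[:, J] = Q_sk R_sk, and define A_pre = A[:, J(1:k)] R_1^{-1}. Let U be an m x rank(A) matrix whose columns form an orthonormal basis for range(A). If rank(S A) = rank(A), then the multiset of singular values of A_pre equals the multiset of reciprocals of the singular values of S U. -/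
open Matrix

/-- The roots of the characteristic polynomial of the inverse of a real symmetric matrix. -/
theorem aux_roots_inv {k : ℕ} (G H : Matrix (Fin k) (Fin k) ℝ) (hG : G.IsHermitian)
    (h : H * G = 1) :
    H.charpoly.roots = Multiset.map (fun i => (hG.eigenvalues i)⁻¹) Finset.univ.val := by
  have hdet : G.det ≠ 0 := by
    intro h0
    have := congrArg Matrix.det h
    simp [h0] at this
  have hne : ∀ i, hG.eigenvalues i ≠ 0 := by
    have h1 := hG.det_eq_prod_eigenvalues
    intro i hi
    apply hdet
    rw [h1]
    exact Finset.prod_eq_zero (Finset.mem_univ i) (by simp [hi])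
  set V : Matrix (Fin k) (Fin k) ℝ := (hG.eigenvectorUnitary : Matrix (Fin k) (Fin k) ℝ) with hV
  have hVV : V * star V = 1 := Unitary.coe_mul_star_self _
  have hVV' : star V * V = 1 := Unitary.coe_star_mul_self _
  have hs : G = V * diagonal hG.eigenvalues * star V := by
    have := hG.spectral_theorem
    rw [Unitary.conjStarAlgAut_apply] at this
    simpa using! this
  have hDD : diagonal hG.eigenvalues * diagonal (fun i => (hG.eigenvalues i)⁻¹) = 1 := by
    rw [diagonal_mul_diagonal, ← diagonal_one]
    congr 1
    funext i
    exact mul_inv_cancel₀ (hne i)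
  have hK : G * (V * diagonal (fun i => (hG.eigenvalues i)⁻¹) * star V) = 1 := by
    calc G * (V * diagonal (fun i => (hG.eigenvalues i)⁻¹) * star V)
        = V * diagonal hG.eigenvalues * (star V * V) *
            diagonal (fun i => (hG.eigenvalues i)⁻¹) * star V := by
          have h0 := congrArg
            (fun M => M * (V * diagonal (fun i => (hG.eigenvalues i)⁻¹) * star V)) hs
          refine h0.trans ?_
          simp only [Matrix.mul_assoc]
      _ = 1 := by
          rw [hVV', Matrix.mul_one, Matrix.mul_assoc V, hDD, Matrix.mul_one, hVV]
  have hH : H = V * diagonal (fun i => (hG.eigenvalues i)⁻¹) * star V := by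
    calc H = H * (G * (V * diagonal (fun i => (hG.eigenvalues i)⁻¹) * star V)) := by
          rw [hK, Matrix.mul_one]
      _ = _ := by rw [← Matrix.mul_assoc, h, Matrix.one_mul]
  rw [hH, charpoly_mul_comm, ← Matrix.mul_assoc, hVV', Matrix.one_mul, charpoly_diagonal,
    Polynomial.roots_prod]
  · simp
  · exact Finset.prod_ne_zero_iff.mpr fun i _ => Polynomial.X_sub_C_ne_zero _

/-- The core of the argument, once the rank is known to be `k`. -/
theorem aux_core {m d k : ℕ} (S : Matrix (Fin d) (Fin m) ℝ) (B : Matrix (Fin m) (Fin k) ℝ)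
    (Q : Matrix (Fin d) (Fin k) ℝ) (hQ : Qᵀ * Q = 1) (hSB : S * B = Q) (r : ℕ)
    (U : Matrix (Fin m) (Fin r) ℝ) (hU : Uᵀ * U = 1) (hr : r = k)
    (T : Matrix (Fin r) (Fin k) ℝ) (hB : B = U * T) :
    svMultiset B = (svMultiset (S * U)).map (fun s => s⁻¹) := by
  subst hr
  have hBB : Bᵀ * B = Tᵀ * T := by
    rw [hB, transpose_mul, Matrix.mul_assoc, ← Matrix.mul_assoc Uᵀ, hU, Matrix.one_mul]
  have h1 : Tᵀ * ((S * U)ᵀ * (S * U) * T) = 1 := by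
    rw [← hQ, ← hSB, hB, ← Matrix.mul_assoc S U T, transpose_mul (S * U) T]
    simp only [Matrix.mul_assoc]
  have h2 : (T * Tᵀ) * ((S * U)ᵀ * (S * U)) = 1 := by
    have h3 := mul_eq_one_comm.mp h1
    rw [Matrix.mul_assoc] at h3
    exact mul_eq_one_comm.mp h3
  have h4 := aux_roots_inv _ _ (gram_isHermitian (S * U)) h2
  rw [charpoly_mul_comm, ← hBB, (gram_isHermitian B).roots_charpoly_eq_eigenvalues] at h4
  have h5 := congrArg (Multiset.map Real.sqrt) h4
  simp only [Multiset.map_map] at h5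
  unfold svMultiset
  rw [Multiset.map_map]
  simpa [Function.comp_def, Real.sqrt_inv] using! h5

/-- Conditioning of the Cholesky QRCP preconditioner: if `rank(SA) = rank(A)`,
then the singular values of `A_pre = A[:, J(1:k)] R₁⁻¹` are the reciprocals of the
singular values of `SU`, where `U` is an orthonormal basis for `range(A)`. -/
theorem sap_chol_qrcp_preconditioner_singular_values {m n d k : ℕ}
    (hnd : n ≤ d) (hk : 0 < k) (hkn : k ≤ n)
    (A : Matrix (Fin m) (Fin n) ℝ) (S : Matrix (Fin d) (Fin m) ℝ)
    (σ : Equiv.Perm (Fin n))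
    (Qsk : Matrix (Fin d) (Fin k) ℝ) (hQsk : Qskᵀ * Qsk = 1)
    (Rsk : Matrix (Fin k) (Fin n) ℝ)
    (hRskTri : ∀ (i : Fin k) (j : Fin n), (j : ℕ) < (i : ℕ) → Rsk i j = 0)
    (hR1 : IsUnit (Rsk.submatrix id (Fin.castLE hkn)))
    (hdecomp : S * A.submatrix id (fun j => σ j) = Qsk * Rsk)
    (U : Matrix (Fin m) (Fin A.rank) ℝ)
    (hUorth : Uᵀ * U = 1)
    (hUrange : LinearMap.range U.mulVecLin = LinearMap.range A.mulVecLin)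
    (hrank : (S * A).rank = A.rank) :
    svMultiset (A.submatrix id (fun i : Fin k => σ (Fin.castLE hkn i)) *
        (Rsk.submatrix id (Fin.castLE hkn))⁻¹)
      = (svMultiset (S * U)).map (fun s => s⁻¹) := by
  have hsub : (S * A).submatrix id σ = Qsk * Rsk := hdecomp
  have hA1 : S * A.submatrix id (fun i : Fin k => σ (Fin.castLE hkn i))
      = Qsk * Rsk.submatrix id (Fin.castLE hkn) := by
    have := congrArg (fun M => M.submatrix id (Fin.castLE hkn)) hdecomp
    exact this
  have hdet : IsUnit (Rsk.submatrix id (Fin.castLE hkn)).det :=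
    (Matrix.isUnit_iff_isUnit_det _).mp hR1
  have hr : A.rank = k := by
    rw [← hrank]
    apply le_antisymm
    · calc (S * A).rank = ((S * A).submatrix (Equiv.refl _) σ).rank :=
            (rank_submatrix _ _ _).symm
        _ = (Qsk * Rsk).rank := by rw [← hsub]; rfl
        _ ≤ Qsk.rank := rank_mul_le_left _ _
        _ ≤ k := rank_le_width _
    · calc k = (Rsk.submatrix id (Fin.castLE hkn)).rank := by
            rw [rank_of_isUnit _ hR1, Fintype.card_fin]
        _ = (Qskᵀ * (S * A.submatrix id (fun i : Fin k => σ (Fin.castLE hkn i)))).rank := by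
            rw [hA1, ← Matrix.mul_assoc, hQsk, Matrix.one_mul]
        _ ≤ (S * A.submatrix id (fun i : Fin k => σ (Fin.castLE hkn i))).rank :=
            rank_mul_le_right _ _
        _ = ((S * A).submatrix id (fun i : Fin k => σ (Fin.castLE hkn i))).rank := rfl
        _ ≤ (S * A).rank := rank_submatrix_le _ _ _
  have hcol : ∀ j, ∃ v, U *ᵥ v = fun i => A i j := by
    intro j
    have hmem : A.mulVecLin (Pi.single j 1) ∈ LinearMap.range U.mulVecLin := by
      rw [hUrange]
      exact ⟨_, rfl⟩
    obtain ⟨v, hv⟩ := hmem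
    refine ⟨v, ?_⟩
    rw [Matrix.mulVecLin_apply, Matrix.mulVecLin_apply, Matrix.mulVec_single_one] at hv
    exact hv
  choose v hv using hcol
  have hAUM : A = U * Matrix.of (fun i j => v j i) := by
    ext i j
    exact (congrFun (hv j) i).symm
  refine aux_core S _ Qsk hQsk ?_ _ U hUorth hr
    ((Matrix.of (fun i j => v j i)).submatrix id (fun i : Fin k => σ (Fin.castLE hkn i)) *
      (Rsk.submatrix id (Fin.castLE hkn))⁻¹) ?_
  · rw [← Matrix.mul_assoc, hA1, Matrix.mul_assoc, Matrix.mul_nonsing_inv _ hdet, Matrix.mul_one]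
  · rw [← Matrix.mul_assoc]
    congr 1
    exact congrArg (fun M => M.submatrix id (fun i : Fin k => σ (Fin.castLE hkn i))) hAUM
end

section
/- Let X be an m x k real matrix, y a vector in R^m, S a d x m real matrix, and u a vector in R^k. If rank( S [X y] ) = rank( [X y] ) and S y = S X u, then y = X u. -/
/-- The matrix `[X y]` obtained by appending `y` as an additional column to `X`. -/
def appendCol {m k : ℕ} (X : Matrix (Fin m) (Fin k) ℝ) (y : Fin m → ℝ) :
    Matrix (Fin m) (Fin (k + 1)) ℝ :=
  Matrix.of fun i j => if h : (j : ℕ) < k then X i ⟨(j : ℕ), h⟩ else y i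

/-- If `rank(S [X y]) = rank([X y])` and `S y = S X u`, then `y = X u`. -/
theorem sketch_rank_preserving_consistency {m k d : ℕ}
    (X : Matrix (Fin m) (Fin k) ℝ) (y : Fin m → ℝ)
    (S : Matrix (Fin d) (Fin m) ℝ) (u : Fin k → ℝ)
    (hrank : (S * appendCol X y).rank = (appendCol X y).rank)
    (hsk : S.mulVec y = S.mulVec (X.mulVec u)) :
    y = X.mulVec u := by
  have hmul : ∀ a : ℝ, ∀ v : Fin k → ℝ,
      (appendCol X y).mulVec (Fin.snoc (α := fun _ => ℝ) v a) = X.mulVec v + a • y := by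
    intro a v
    ext i
    simp [Matrix.mulVec, dotProduct, Fin.sum_univ_castSucc, appendCol, mul_comm]
  have hle : LinearMap.ker (appendCol X y).mulVecLin ≤
      LinearMap.ker (S * appendCol X y).mulVecLin := by
    intro v hv
    simp only [LinearMap.mem_ker, Matrix.mulVecLin_apply] at hv ⊢
    rw [← Matrix.mulVec_mulVec, hv, Matrix.mulVec_zero]
  have h1 := LinearMap.finrank_range_add_finrank_ker (appendCol X y).mulVecLin
  have h2 := LinearMap.finrank_range_add_finrank_ker (S * appendCol X y).mulVecLin
  unfold Matrix.rank at hrank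
  have heq := Submodule.eq_of_le_of_finrank_eq hle (by omega)
  have hmem : (Fin.snoc (α := fun _ => ℝ) u (-1) : Fin (k + 1) → ℝ) ∈
      LinearMap.ker (S * appendCol X y).mulVecLin := by
    rw [LinearMap.mem_ker, Matrix.mulVecLin_apply, ← Matrix.mulVec_mulVec, hmul,
      Matrix.mulVec_add, Matrix.mulVec_smul, hsk]
    simp
  rw [← heq, LinearMap.mem_ker, Matrix.mulVecLin_apply, hmul] at hmem
  have h3 : X.mulVec u - y = 0 := by
    rw [← hmem]
    simp [sub_eq_add_neg]
  exact (sub_eq_zero.mp h3).symm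
end

section
/- Let A be an m x n real matrix with m >= n, b a vector in R^m, and c a vector in R^n. For mu > 0 define y(mu) = (A A^T + mu I_m)^{-1} (A c + mu b). Then y(mu) converges, as mu tends to 0 from the right, to (A^T)^dagger c + (I_m - A A^dagger) b. -/
open Matrix

theorem resolvent_bound {m n : ℕ} (A : Matrix (Fin m) (Fin n) ℝ) (μ : ℝ) (hμ : 0 < μ)
    (z w : Fin m → ℝ)
    (h : (A * Aᵀ + μ • (1 : Matrix (Fin m) (Fin m) ℝ)).mulVec z = w) (i : Fin m) :
    |μ * z i| ≤ Real.sqrt (w ⬝ᵥ w) := by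
  have h0 : z ⬝ᵥ w = (Aᵀ *ᵥ z) ⬝ᵥ (Aᵀ *ᵥ z) + μ * (z ⬝ᵥ z) := by
    rw [← h, Matrix.add_mulVec, dotProduct_add, Matrix.smul_mulVec, Matrix.one_mulVec,
      dotProduct_smul, smul_eq_mul, ← Matrix.mulVec_mulVec, Matrix.dotProduct_mulVec,
      ← Matrix.mulVec_transpose]
  have h1 : 0 ≤ (Aᵀ *ᵥ z) ⬝ᵥ (Aᵀ *ᵥ z) :=
    Finset.sum_nonneg fun j _ => mul_self_nonneg _
  have h2 : 0 ≤ (w - μ • z) ⬝ᵥ (w - μ • z) :=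
    Finset.sum_nonneg fun j _ => mul_self_nonneg _
  have h3 : z i * z i ≤ z ⬝ᵥ z :=
    Finset.single_le_sum (f := fun j => z j * z j) (fun j _ => mul_self_nonneg _)
      (Finset.mem_univ i)
  simp only [sub_dotProduct, dotProduct_sub, smul_dotProduct, dotProduct_smul, smul_eq_mul] at h2
  rw [dotProduct_comm w z] at h2
  apply Real.abs_le_sqrt
  have h4 : μ * (μ * (z ⬝ᵥ z)) ≤ μ * (z ⬝ᵥ w) := by
    apply mul_le_mul_of_nonneg_left _ hμ.le
    linarith
  have h5 : μ * (μ * (z i * z i)) ≤ μ * (μ * (z ⬝ᵥ z)) := by gcongr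
  have h6 : 0 ≤ ((Aᵀ *ᵥ z) ⬝ᵥ (Aᵀ *ᵥ z)) * μ := by positivity
  nlinarith

/-- As `μ → 0⁺`, `y(μ) = (AAᵀ + μI)⁻¹(Ac + μb)` converges to
`(Aᵀ)† c + (I - AA†) b`. -/
theorem limiting_dual_saddle_solution {m n : ℕ} (hmn : n ≤ m)
    (A : Matrix (Fin m) (Fin n) ℝ) (b : Fin m → ℝ) (c : Fin n → ℝ)
    (Adag : Matrix (Fin n) (Fin m) ℝ) (hAdag : IsMoorePenrose A Adag)
    (ATdag : Matrix (Fin m) (Fin n) ℝ) (hATdag : IsMoorePenrose Aᵀ ATdag) :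
    Filter.Tendsto
      (fun μ : ℝ => ((A * Aᵀ + μ • (1 : Matrix (Fin m) (Fin m) ℝ))⁻¹).mulVec
        (A.mulVec c + μ • b))
      (nhdsWithin (0 : ℝ) (Set.Ioi 0))
      (nhds (ATdag.mulVec c + (1 - A * Adag).mulVec b)) := by
  obtain ⟨a1, a2, a3, a4⟩ := hAdag
  obtain ⟨t1, t2, t3, t4⟩ := hATdag
  have e1 : A * Aᵀ * ATdag = A := by
    have := congrArg Matrix.transpose t1
    rw [Matrix.transpose_mul, t3, Matrix.transpose_transpose, ← Matrix.mul_assoc] at this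
    exact this
  have e2 : A * Aᵀ * (A * Adag) = A * Aᵀ := by
    have := congrArg Matrix.transpose a1
    rw [Matrix.transpose_mul, a3] at this
    rw [Matrix.mul_assoc, this]
  have e3 : A * Aᵀ * (Adagᵀ * Adag) = A * Adag := by
    have h : Aᵀ * Adagᵀ = Adag * A := by rw [← Matrix.transpose_mul, a4]
    rw [Matrix.mul_assoc, ← Matrix.mul_assoc Aᵀ, h, a2]
  have e4 : A * Aᵀ * (ATdag * ATdagᵀ * ATdag) = ATdag := by
    have h : A * ATdagᵀ = ATdag * Aᵀ := by
      rw [← t4, Matrix.transpose_mul, Matrix.transpose_transpose]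
    rw [Matrix.mul_assoc ATdag, ← Matrix.mul_assoc, e1, ← Matrix.mul_assoc, h, t2]
  set w : Fin m → ℝ := (Adagᵀ * Adag) *ᵥ b - (ATdag * ATdagᵀ * ATdag) *ᵥ c with hw
  set L : Fin m → ℝ := ATdag.mulVec c + (1 - A * Adag).mulVec b with hL
  have hMw : (A * Aᵀ) *ᵥ w = (A * Adag) *ᵥ b - ATdag *ᵥ c := by
    rw [hw, Matrix.mulVec_sub, Matrix.mulVec_mulVec, Matrix.mulVec_mulVec, e3, e4]
  have hML : (A * Aᵀ) *ᵥ L = A *ᵥ c := by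
    rw [hL, Matrix.mulVec_add, Matrix.mulVec_mulVec, Matrix.mulVec_mulVec, e1,
      Matrix.mul_sub, Matrix.mul_one, e2, sub_self, Matrix.zero_mulVec, add_zero]
  have hLb : L = b - (A * Aᵀ) *ᵥ w := by
    rw [hMw, hL, Matrix.sub_mulVec, Matrix.one_mulVec]; abel
  have key : ∀ μ : ℝ, 0 < μ → ∀ i,
      |(((A * Aᵀ + μ • (1 : Matrix (Fin m) (Fin m) ℝ))⁻¹).mulVec
        (A.mulVec c + μ • b)) i - L i| ≤ μ * (|w i| + Real.sqrt (w ⬝ᵥ w)) := by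
    intro μ hμ i
    have hu : IsUnit (A * Aᵀ + μ • (1 : Matrix (Fin m) (Fin m) ℝ)).det := by
      rw [← Matrix.isUnit_iff_isUnit_det]
      apply Matrix.PosDef.isUnit
      have p1 : (A * Aᵀ).PosSemidef := by
        have := Matrix.posSemidef_self_mul_conjTranspose A
        rwa [Matrix.conjTranspose_eq_transpose_of_trivial] at this
      exact Matrix.PosDef.posSemidef_add p1 (Matrix.PosDef.one.smul hμ)
    set N := A * Aᵀ + μ • (1 : Matrix (Fin m) (Fin m) ℝ) with hN
    have hNz : N *ᵥ (N⁻¹ *ᵥ w) = w := by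
      rw [Matrix.mulVec_mulVec, Matrix.mul_nonsing_inv _ hu, Matrix.one_mulVec]
    have hNv : ∀ v, N *ᵥ v = (A * Aᵀ) *ᵥ v + μ • v := fun v => by
      rw [hN, Matrix.add_mulVec, Matrix.smul_mulVec, Matrix.one_mulVec]
    have hb := resolvent_bound A μ hμ (N⁻¹ *ᵥ w) w hNz i
    have hy : A *ᵥ c + μ • b = N *ᵥ (L + μ • (w - μ • (N⁻¹ *ᵥ w))) := by
      rw [Matrix.mulVec_add, Matrix.mulVec_smul, Matrix.mulVec_sub, Matrix.mulVec_smul, hNz,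
        hNv, hNv, hML, add_sub_cancel_right, add_assoc, ← smul_add, hLb, sub_add_cancel]
    rw [hy, Matrix.mulVec_mulVec, Matrix.nonsing_inv_mul _ hu, Matrix.one_mulVec]
    simp only [Pi.add_apply, Pi.smul_apply, Pi.sub_apply, smul_eq_mul, add_sub_cancel_left]
    rw [abs_mul, abs_of_pos hμ]
    apply mul_le_mul_of_nonneg_left _ hμ.le
    exact (abs_sub _ _).trans (by linarith)
  rw [tendsto_pi_nhds]
  intro i
  rw [tendsto_iff_dist_tendsto_zero]
  refine squeeze_zero' (g := fun μ : ℝ => μ * (|w i| + Real.sqrt (w ⬝ᵥ w)))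
    (Filter.Eventually.of_forall fun _ => dist_nonneg) ?_ ?_
  · filter_upwards [self_mem_nhdsWithin] with μ hμ
    rw [Real.dist_eq]
    exact key μ hμ i
  · have : Continuous fun μ : ℝ => μ * (|w i| + Real.sqrt (w ⬝ᵥ w)) := by fun_prop
    have := (this.tendsto 0).mono_left (nhdsWithin_le_nhds (s := Set.Ioi 0))
    simpa using this
end

section
/- Let A be an m x n real matrix with m >= n, b a vector in R^m, and c a vector in R^n. For mu > 0 define x(mu) = (A^T A + mu I_n)^{-1} (A^T b - c). If c is orthogonal to the kernel of A (equivalently, c lies in range(A^T)), then x(mu) converges, as mu tends to 0 from the right, to (A^T A)^dagger (A^T b - c). If c is not orthogonal to the kernel of A, then ||x(mu)||_2 diverges to +infinity as mu tends to 0 from the right. -/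
open Matrix

lemma aux_inv {m n : ℕ} (A : Matrix (Fin m) (Fin n) ℝ) {μ : ℝ} (hμ : 0 < μ) :
    IsUnit (Aᵀ * A + μ • (1 : Matrix (Fin n) (Fin n) ℝ)).det := by
  have h1 : (Aᵀ * A).PosSemidef := by
    simpa using Matrix.posSemidef_conjTranspose_mul_self A
  have h2 : (μ • (1 : Matrix (Fin n) (Fin n) ℝ)).PosDef := Matrix.PosDef.one.smul hμ
  exact (Matrix.isUnit_iff_isUnit_det _).1 (Matrix.PosDef.posSemidef_add h1 h2).isUnit

lemma aux_solve {m n : ℕ} (A : Matrix (Fin m) (Fin n) ℝ) {μ : ℝ} (hμ : 0 < μ)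
    (v : Fin n → ℝ) :
    (Aᵀ * A) *ᵥ ((Aᵀ * A + μ • (1 : Matrix (Fin n) (Fin n) ℝ))⁻¹ *ᵥ v)
      + μ • ((Aᵀ * A + μ • (1 : Matrix (Fin n) (Fin n) ℝ))⁻¹ *ᵥ v) = v := by
  have h := Matrix.mul_nonsing_inv _ (aux_inv A hμ)
  have h2 := congrArg (fun M => M *ᵥ v) h
  simp only [← Matrix.mulVec_mulVec, Matrix.add_mulVec, Matrix.smul_mulVec, Matrix.one_mulVec] at h2
  rw [← Matrix.mulVec_mulVec]
  exact h2

lemma aux_left {m n : ℕ} (A : Matrix (Fin m) (Fin n) ℝ) {μ : ℝ} (hμ : 0 < μ)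
    (w : Fin n → ℝ) :
    (Aᵀ * A + μ • (1 : Matrix (Fin n) (Fin n) ℝ))⁻¹ *ᵥ ((Aᵀ * A) *ᵥ w)
      = w - μ • ((Aᵀ * A + μ • (1 : Matrix (Fin n) (Fin n) ℝ))⁻¹ *ᵥ w) := by
  have h := Matrix.nonsing_inv_mul _ (aux_inv A hμ)
  have h2 := congrArg (fun M => M *ᵥ w) h
  simp only [← Matrix.mulVec_mulVec, Matrix.add_mulVec, Matrix.smul_mulVec, Matrix.one_mulVec,
    Matrix.mulVec_add, Matrix.mulVec_smul] at h2
  rw [← Matrix.mulVec_mulVec]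
  exact eq_sub_of_add_eq h2

lemma aux_bound {m n : ℕ} (A : Matrix (Fin m) (Fin n) ℝ) {μ : ℝ} (hμ : 0 < μ)
    (z : Fin n → ℝ) (i : Fin n) :
    |μ * ((Aᵀ * A + μ • (1 : Matrix (Fin n) (Fin n) ℝ))⁻¹ *ᵥ z) i| ≤ √(z ⬝ᵥ z) := by
  have h := aux_solve A hμ z
  set y := (Aᵀ * A + μ • (1 : Matrix (Fin n) (Fin n) ℝ))⁻¹ *ᵥ z
  set g := (Aᵀ * A) *ᵥ y with hg
  have hgy : 0 ≤ y ⬝ᵥ g := by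
    rw [hg, ← Matrix.mulVec_mulVec, Matrix.dotProduct_mulVec, Matrix.vecMul_transpose]
    exact Finset.sum_nonneg fun j _ => mul_self_nonneg _
  have hgg : 0 ≤ g ⬝ᵥ g := Finset.sum_nonneg fun j _ => mul_self_nonneg _
  have hyy : y i * y i ≤ y ⬝ᵥ y :=
    Finset.single_le_sum (f := fun j => y j * y j) (fun j _ => mul_self_nonneg _)
      (Finset.mem_univ i)
  have hz : z ⬝ᵥ z = g ⬝ᵥ g + 2 * μ * (y ⬝ᵥ g) + μ ^ 2 * (y ⬝ᵥ y) := by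
    rw [← h]
    simp only [add_dotProduct, dotProduct_add, smul_dotProduct, dotProduct_smul, smul_eq_mul]
    rw [dotProduct_comm g y]; ring
  apply Real.abs_le_sqrt
  rw [hz]
  have := mul_le_mul_of_nonneg_left hyy (sq_nonneg μ)
  have := mul_nonneg hμ.le hgy
  nlinarith

/-- As `μ → 0⁺`, `x(μ) = (AᵀA + μI)⁻¹(Aᵀb - c)` converges to `(AᵀA)†(Aᵀb - c)`
when `c ∈ range(Aᵀ)` (i.e. `c ⟂ ker A`), and `‖x(μ)‖₂` diverges to `+∞` otherwise. -/
theorem limiting_primal_saddle_solution {m n : ℕ} (hmn : n ≤ m)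
    (A : Matrix (Fin m) (Fin n) ℝ) (b : Fin m → ℝ) (c : Fin n → ℝ)
    (Gdag : Matrix (Fin n) (Fin n) ℝ) (hGdag : IsMoorePenrose (Aᵀ * A) Gdag) :
    (c ∈ LinearMap.range (Aᵀ).mulVecLin →
      Filter.Tendsto
        (fun μ : ℝ => ((Aᵀ * A + μ • (1 : Matrix (Fin n) (Fin n) ℝ))⁻¹).mulVec
          (Aᵀ.mulVec b - c))
        (nhdsWithin (0 : ℝ) (Set.Ioi 0))
        (nhds (Gdag.mulVec (Aᵀ.mulVec b - c)))) ∧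
    (c ∉ LinearMap.range (Aᵀ).mulVecLin →
      Filter.Tendsto
        (fun μ : ℝ => Real.sqrt (∑ i,
          (((Aᵀ * A + μ • (1 : Matrix (Fin n) (Fin n) ℝ))⁻¹).mulVec
            (Aᵀ.mulVec b - c)) i ^ 2))
        (nhdsWithin (0 : ℝ) (Set.Ioi 0)) Filter.atTop) := by
  obtain ⟨h1, h2, h3, h4⟩ := hGdag
  set G := Aᵀ * A with hG
  have hGt : Gᵀ = G := by simp [hG]
  have hE : Gdag * G = G * Gdagᵀ := by
    rw [← h4, Matrix.transpose_mul, hGt]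
  have hEA : Gdag * G * Aᵀ = Aᵀ := by
    have e1 : Aᵀ * (A * (Gdag * G) - A) = 0 := by
      rw [Matrix.mul_sub, ← Matrix.mul_assoc, ← hG, ← Matrix.mul_assoc, h1, sub_self]
    have e2 : A * (Gdag * G) - A = 0 := by
      have : Aᴴ * A * ((Gdag * G) - 1) = 0 := by
        rw [Matrix.conjTranspose_eq_transpose_of_trivial, Matrix.mul_assoc, Matrix.mul_sub,
          Matrix.mul_one]
        exact e1
      have := (Matrix.conjTranspose_mul_self_mul_eq_zero A _).1 this
      rwa [Matrix.mul_sub, Matrix.mul_one] at this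
    have e3 := congrArg Matrix.transpose (sub_eq_zero.1 e2)
    rwa [Matrix.transpose_mul, h4] at e3
  constructor
  · rintro ⟨d, rfl⟩
    set v := Aᵀ *ᵥ b - (Aᵀ).mulVecLin d with hv
    have hv' : v = Aᵀ *ᵥ (b - d) := by
      rw [hv, Matrix.mulVec_sub, Matrix.mulVecLin_apply]
    have hEv : (Gdag * G) *ᵥ v = v := by rw [hv', Matrix.mulVec_mulVec, hEA]
    have hGx : G *ᵥ (Gdag *ᵥ v) = v := by
      conv_rhs => rw [← hEv, hE, ← h1]
      conv_lhs => rw [← hEv, hE]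
      simp only [Matrix.mulVec_mulVec, Matrix.mul_assoc]
    set x := Gdag *ᵥ v with hx
    have hxz : G *ᵥ (Gdagᵀ *ᵥ x) = x := by
      rw [Matrix.mulVec_mulVec, ← hE, hx, Matrix.mulVec_mulVec, h2]
    set z := Gdagᵀ *ᵥ x
    have key : ∀ μ : ℝ, 0 < μ → (G + μ • (1 : Matrix (Fin n) (Fin n) ℝ))⁻¹ *ᵥ v
        = x - μ • (z - μ • ((G + μ • (1 : Matrix (Fin n) (Fin n) ℝ))⁻¹ *ᵥ z)) := by
      intro μ hμ
      have k1 := aux_left A hμ x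
      have k2 := aux_left A hμ z
      rw [← hG] at k1 k2
      rw [hGx] at k1
      rw [hxz] at k2
      rw [k1, k2]
    rw [tendsto_pi_nhds]
    intro i
    rw [tendsto_iff_norm_sub_tendsto_zero]
    have hlim : Filter.Tendsto (fun μ : ℝ => μ * (|z i| + √(z ⬝ᵥ z)))
        (nhdsWithin (0 : ℝ) (Set.Ioi 0)) (nhds 0) := by
      have : Filter.Tendsto (fun μ : ℝ => μ * (|z i| + √(z ⬝ᵥ z))) (nhds 0)
          (nhds (0 * (|z i| + √(z ⬝ᵥ z)))) := Filter.Tendsto.mul_const _ Filter.tendsto_id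
      rw [zero_mul] at this
      exact this.mono_left nhdsWithin_le_nhds
    refine squeeze_zero' (Filter.Eventually.of_forall fun _ => norm_nonneg _) ?_ hlim
    filter_upwards [self_mem_nhdsWithin] with μ hμ
    have hμ' : 0 < μ := hμ
    have hb := aux_bound A hμ' z i
    rw [← hG] at hb
    rw [key μ hμ']
    simp only [Pi.sub_apply, Pi.smul_apply, smul_eq_mul, Real.norm_eq_abs]
    rw [sub_sub_cancel_left, abs_neg, abs_mul, abs_of_pos hμ']
    refine mul_le_mul_of_nonneg_left ((abs_sub _ _).trans ?_) hμ'.le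
    gcongr
  · intro hc
    set v := Aᵀ *ᵥ b - c with hv
    set q := v - (Gdag * G) *ᵥ v with hq
    have hGq : G *ᵥ q = 0 := by
      rw [hq, Matrix.mulVec_sub, Matrix.mulVec_mulVec, ← Matrix.mul_assoc, h1, sub_self]
    have hq0 : q ≠ 0 := by
      intro h0
      apply hc
      have e : v = (Gdag * G) *ᵥ v := sub_eq_zero.1 h0
      refine ⟨b - A *ᵥ (Gdagᵀ *ᵥ v), ?_⟩
      rw [Matrix.mulVecLin_apply, Matrix.mulVec_sub, Matrix.mulVec_mulVec, ← hG,
        Matrix.mulVec_mulVec, ← hE, ← e, hv, sub_sub_cancel]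
    have hqq : q ⬝ᵥ v = q ⬝ᵥ q := by
      have : q ⬝ᵥ ((Gdag * G) *ᵥ v) = 0 := by
        rw [hE, ← Matrix.mulVec_mulVec, Matrix.dotProduct_mulVec, ← Matrix.mulVec_transpose, hGt,
          hGq, zero_dotProduct]
      conv_rhs => rw [hq, dotProduct_sub, ← hq, this, sub_zero]
    have hpos : 0 < q ⬝ᵥ q := by
      have h0 : 0 ≤ q ⬝ᵥ q := Finset.sum_nonneg fun j _ => mul_self_nonneg _
      exact lt_of_le_of_ne h0 fun h => hq0 (dotProduct_self_eq_zero.1 h.symm)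
    have hlim : Filter.Tendsto (fun μ : ℝ => √(q ⬝ᵥ q) * μ⁻¹)
        (nhdsWithin (0 : ℝ) (Set.Ioi 0)) Filter.atTop :=
      Filter.Tendsto.const_mul_atTop (Real.sqrt_pos.2 hpos) tendsto_inv_nhdsGT_zero
    refine Filter.tendsto_atTop_mono' _ ?_ hlim
    filter_upwards [self_mem_nhdsWithin] with μ hμ
    have hμ' : 0 < μ := hμ
    have hs := aux_solve A hμ' v
    rw [← hG] at hs
    set x := (G + μ • (1 : Matrix (Fin n) (Fin n) ℝ))⁻¹ *ᵥ v
    have e : q ⬝ᵥ q = μ * (q ⬝ᵥ x) := by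
      rw [← hqq, ← hs, dotProduct_add, Matrix.dotProduct_mulVec, ← Matrix.mulVec_transpose, hGt,
        hGq, zero_dotProduct, zero_add, dotProduct_smul, smul_eq_mul]
    have cs : q ⬝ᵥ x ≤ √(q ⬝ᵥ q) * √(∑ i, x i ^ 2) := by
      have := Real.sum_mul_le_sqrt_mul_sqrt Finset.univ q x
      simpa [dotProduct, pow_two] using this
    have hsq := Real.mul_self_sqrt hpos.le
    have hsp := Real.sqrt_pos.2 hpos
    rw [← div_eq_mul_inv, div_le_iff₀ hμ']
    refine le_of_mul_le_mul_left ?_ hsp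
    rw [hsq, e]
    have := mul_le_mul_of_nonneg_left cs hμ'.le
    rw [← e] at *
    linarith
end
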